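/- arXiv:0710.1816 — 4 statements merged into one kernel-verified Lean document; each statement's English description precedes it below -/
import Mathlib

section
/- Let λ and π be partitions of [n], both with exactly k blocks. If the multisets {al(μ) : μ ∈ T(λ,l)} and {al(μ) : μ ∈ T(π,l)} are equal for l = 0 and l = 1, then the multisets {al(μ) : μ ∈ T(λ,l,m)} and {al(μ) : μ ∈ T(π,l,m)} are equal for all l, m ≥ 0. -/
open Finset

/-- A set partition of `[n] = {1,…,n}`, modeled as a `Finpartition` of `Fin n`. -/
abbrev SetPartition (n : ℕ) := Finpartition (Finset.univ : Finset (Fin n))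

/-- `(i,j)` is an arc of the partition `p`: `i < j`, they lie in a common block,
and no element of that block lies strictly between them. -/
def IsArc {n : ℕ} (p : SetPartition n) (i j : Fin n) : Prop :=
  i < j ∧ ∃ B ∈ p.parts, i ∈ B ∧ j ∈ B ∧ ∀ x ∈ B, ¬ (i < x ∧ x < j)

/-- Arcs `a = (i₁,j₁)` and `b = (i₂,j₂)` form a crossing: `i₁ < i₂ < j₁ < j₂`. -/
def Crossing {n : ℕ} (a b : Fin n × Fin n) : Prop :=
  a.1 < b.1 ∧ b.1 < a.2 ∧ a.2 < b.2

/-- Arcs `a = (i₁,j₁)` and `b = (i₂,j₂)` form a nesting: `i₁ < i₂ < j₂ < j₁`. -/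
def Nesting {n : ℕ} (a b : Fin n × Fin n) : Prop :=
  a.1 < b.1 ∧ b.1 < b.2 ∧ b.2 < a.2

/-- `cr p`: the number of crossings of two arcs in `p`. -/
noncomputable def cr {n : ℕ} (p : SetPartition n) : ℕ :=
  {e : (Fin n × Fin n) × (Fin n × Fin n) |
    IsArc p e.1.1 e.1.2 ∧ IsArc p e.2.1 e.2.2 ∧ Crossing e.1 e.2}.ncard

/-- `ne' p`: the number of nestings of two arcs in `p`. -/
noncomputable def ne' {n : ℕ} (p : SetPartition n) : ℕ :=
  {e : (Fin n × Fin n) × (Fin n × Fin n) |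
    IsArc p e.1.1 e.1.2 ∧ IsArc p e.2.1 e.2.2 ∧ Nesting e.1 e.2}.ncard

/-- `al p`: the number of alignments (unordered pairs of arcs that neither
cross nor nest, counted with first endpoints in increasing order). -/
noncomputable def al {n : ℕ} (p : SetPartition n) : ℕ :=
  {e : (Fin n × Fin n) × (Fin n × Fin n) |
    IsArc p e.1.1 e.1.2 ∧ IsArc p e.2.1 e.2.2 ∧ e.1.1 < e.2.1 ∧
    ¬ Crossing e.1 e.2 ∧ ¬ Crossing e.2 e.1 ∧
    ¬ Nesting e.1 e.2 ∧ ¬ Nesting e.2 e.1}.ncard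

/-- `i` and `j` lie in a common block of `p`. -/
def InSameBlock {n : ℕ} (p : SetPartition n) (i j : Fin n) : Prop :=
  ∃ B ∈ p.parts, i ∈ B ∧ j ∈ B

/-- `c` (a partition of `[n+1]`) is a child of `p` (a partition of `[n]`):
deleting the element `1` from `c` and shifting down by one yields `p`. -/
def IsChild {n : ℕ} (c : SetPartition (n + 1)) (p : SetPartition n) : Prop :=
  ∀ i j : Fin n, (InSameBlock p i j ↔ InSameBlock c i.succ j.succ)

/-- `level p l` is `T(p, l)`: the set of partitions of `[n+l]` at the `l`-th level of
the subtree rooted at `p` in the tree of partitions. -/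
def level {n : ℕ} (p : SetPartition n) : (l : ℕ) → Set (SetPartition (n + l))
  | 0 => {p}
  | l + 1 => {c | ∃ q ∈ level p l, IsChild c q}

/-- The statistic `s_{α,β}(p) = cr(p)·α + ne(p)·β`. -/
noncomputable def statS {G : Type*} [AddCommGroup G] (α β : G) {n : ℕ} (p : SetPartition n) : G :=
  cr p • α + ne' p • β

namespace SetPartition

variable {n : ℕ}

lemma inSameBlock_iff (p : SetPartition n) (i j : Fin n) :
    InSameBlock p i j ↔ p.part i = p.part j := by
  rw [← p.mem_part_iff_part_eq_part (mem_univ i) (mem_univ j), p.mem_part_iff_exists]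
  rfl

lemma isArc_iff (p : SetPartition n) (i j : Fin n) :
    IsArc p i j ↔
      i < j ∧ p.part i = p.part j ∧ ∀ x, i < x → x < j → p.part i ≠ p.part x := by
  constructor
  · rintro ⟨hij, B, hB, hi, hj, h⟩
    have hBi := p.part_eq_of_mem hB hi
    refine ⟨hij, hBi.trans (p.part_eq_of_mem hB hj).symm, fun x hix hxj hx => h x ?_ ⟨hix, hxj⟩⟩
    rw [← hBi, hx]
    exact p.mem_part (mem_univ x)
  · rintro ⟨hij, hp, h⟩
    refine ⟨hij, p.part i, p.part_mem.2 (mem_univ i), p.mem_part (mem_univ i),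
      hp ▸ p.mem_part (mem_univ j), fun x hx hx' => h x hx'.1 hx'.2 ?_⟩
    exact ((p.mem_part_iff_part_eq_part (mem_univ x) (mem_univ i)).1 hx).symm

lemma ext_part {p q : SetPartition n} (h : ∀ i j, p.part i = p.part j ↔ q.part i = q.part j) :
    p = q := by
  have hpart : ∀ i, p.part i = q.part i := fun i => by
    ext j
    rw [p.mem_part_iff_part_eq_part (mem_univ j) (mem_univ i), h,
      q.mem_part_iff_part_eq_part (mem_univ j) (mem_univ i)]
  ext B : 2
  constructor
  · intro hB
    obtain ⟨i, hi⟩ := p.nonempty_of_mem_parts hB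
    rw [← p.part_eq_of_mem hB hi, hpart]
    exact q.part_mem.2 (mem_univ i)
  · intro hB
    obtain ⟨i, hi⟩ := q.nonempty_of_mem_parts hB
    rw [← q.part_eq_of_mem hB hi, ← hpart]
    exact p.part_mem.2 (mem_univ i)

/-- The smallest elements of the blocks of `p`. -/
def minima (p : SetPartition n) : Finset (Fin n) :=
  {b | ∀ x < b, p.part x ≠ p.part b}

open Classical in
/-- The arcs of `p`. -/
noncomputable def arcs (p : SetPartition n) : Finset (Fin n × Fin n) :=
  {e | IsArc p e.1 e.2}

/-- The number of arcs of `p` whose left endpoint is at least `b`. -/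
noncomputable def arcsFrom (p : SetPartition n) (b : Fin n) : ℕ :=
  #{e ∈ arcs p | b ≤ e.1}

/-- The number of arcs, the number of alignments, and the multiset of the values `arcsFrom p b`
as `b` runs over the smallest elements of the blocks. -/
noncomputable def profile (p : SetPartition n) : ℕ × ℕ × Multiset ℕ :=
  (#(arcs p), al p, (minima p).val.map (arcsFrom p))

/-- The profiles of the children of a partition with the given profile. -/
def nextProfiles (s : ℕ × ℕ × Multiset ℕ) : Multiset (ℕ × ℕ × Multiset ℕ) :=
  (s.1, s.2.1, s.1 ::ₘ s.2.2) ::ₘ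
    s.2.2.map fun x => (s.1 + 1, s.2.1 + x, (s.1 + 1) ::ₘ s.2.2.erase x)

lemma mem_minima {p : SetPartition n} {b : Fin n} :
    b ∈ minima p ↔ ∀ x < b, p.part x ≠ p.part b := by
  simp [minima]

lemma mem_arcs {p : SetPartition n} {e : Fin n × Fin n} : e ∈ arcs p ↔ IsArc p e.1 e.2 := by
  simp [arcs]

lemma eq_of_mem_minima {p : SetPartition n} {a b : Fin n} (ha : a ∈ minima p)
    (hb : b ∈ minima p) (h : p.part a = p.part b) : a = b := by
  rw [mem_minima] at ha hb
  rcases lt_trichotomy a b with hab | hab | hab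
  · exact absurd h (hb a hab)
  · exact hab
  · exact absurd h.symm (ha b hab)

lemma exists_mem_minima (p : SetPartition n) (i : Fin n) :
    ∃ b ∈ minima p, b ≤ i ∧ p.part b = p.part i := by
  induction i using WellFoundedLT.induction with
  | ind i ih =>
    by_cases hi : i ∈ minima p
    · exact ⟨i, hi, le_rfl, rfl⟩
    · simp only [mem_minima, not_forall, not_not] at hi
      obtain ⟨x, hx, hxi⟩ := hi
      obtain ⟨b, hb, hbx, hp⟩ := ih x hx
      exact ⟨b, hb, hbx.trans hx.le, hp.trans hxi⟩

lemma card_minima (p : SetPartition n) : #(minima p) = #p.parts := by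
  refine card_bij (fun b _ => p.part b) (fun b _ => p.part_mem.2 (mem_univ b))
    (fun a ha b hb h => eq_of_mem_minima ha hb h) fun B hB => ?_
  obtain ⟨i, hi⟩ := p.nonempty_of_mem_parts hB
  obtain ⟨b, hb, -, hbi⟩ := exists_mem_minima p i
  exact ⟨b, hb, hbi.trans (p.part_eq_of_mem hB hi)⟩

lemma card_arcs (p : SetPartition n) : #(arcs p) = ((minima p).val.map (arcsFrom p)).sup := by
  apply le_antisymm
  · rcases n with - | n
    · simp [arcs]
    · have h0 : (0 : Fin (n + 1)) ∈ minima p := by simp [mem_minima]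
      have : arcsFrom p 0 = #(arcs p) := by simp [arcsFrom]
      rw [← this]
      exact Multiset.le_sup (Multiset.mem_map_of_mem _ h0)
  · rw [Multiset.sup_le]
    intro x hx
    obtain ⟨b, -, rfl⟩ := Multiset.mem_map.1 hx
    exact card_filter_le _ _

/-- The block of `p`, if any, that an element of `[n+1]` belongs to in the child of `p` in which
`1` is added to the block of `o`, or forms a block of its own when `o = none`. -/
def childLabel (p : SetPartition n) (o : Option (Fin n)) : Fin (n + 1) → Option (Finset (Fin n)) :=
  Fin.cases (o.map p.part) fun i => some (p.part i)

/-- The child of `p` in which `1` is added to the block of `o`, or forms a block of its own when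
`o = none`. -/
noncomputable def attach (p : SetPartition n) (o : Option (Fin n)) : SetPartition (n + 1) :=
  open Classical in Finpartition.ofSetoid (Setoid.ker (childLabel p o))

lemma part_attach_eq_iff (p : SetPartition n) (o : Option (Fin n)) (x y : Fin (n + 1)) :
    (attach p o).part x = (attach p o).part y ↔ childLabel p o x = childLabel p o y := by
  classical
  rw [← Finpartition.mem_part_iff_part_eq_part _ (mem_univ x) (mem_univ y), attach,
    Finpartition.mem_part_ofSetoid_iff_rel]
  exact eq_comm

@[simp] lemma part_attach_succ (p : SetPartition n) (o : Option (Fin n)) (i j : Fin n) :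
    (attach p o).part i.succ = (attach p o).part j.succ ↔ p.part i = p.part j := by
  simp [part_attach_eq_iff, childLabel]

@[simp] lemma part_attach_zero_succ (p : SetPartition n) (o : Option (Fin n)) (i : Fin n) :
    (attach p o).part 0 = (attach p o).part i.succ ↔ ∃ b ∈ o, p.part b = p.part i := by
  simp [part_attach_eq_iff, childLabel]

lemma isChild_iff {p : SetPartition n} {c : SetPartition (n + 1)} :
    IsChild c p ↔ ∃ o ∈ insertNone (minima p), attach p o = c := by
  simp only [IsChild, inSameBlock_iff]
  constructor
  · intro h
    have key : ∀ o : Option (Fin n),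
        (∀ i : Fin n, c.part 0 = c.part i.succ ↔ ∃ b ∈ o, p.part b = p.part i) →
          attach p o = c := by
      intro o ho
      refine ext_part fun x y => ?_
      cases x using Fin.cases <;> cases y using Fin.cases
      · simp
      · rw [part_attach_zero_succ, ho]
      · rw [eq_comm, part_attach_zero_succ, eq_comm (a := c.part _), ho]
      · rw [part_attach_succ, h]
    by_cases h0 : ∃ i : Fin n, c.part 0 = c.part i.succ
    · obtain ⟨i, hi⟩ := h0
      obtain ⟨b, hb, -, hbi⟩ := exists_mem_minima p i
      refine ⟨some b, by simpa using hb, key _ fun j => ?_⟩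
      simp [hi, ← h, hbi]
    · push Not at h0
      exact ⟨none, by simp, key _ fun i => by simp [h0]⟩
  · rintro ⟨o, -, rfl⟩ i j
    simp

lemma attach_injOn (p : SetPartition n) : Set.InjOn (attach p) (insertNone (minima p)) := by
  have key : ∀ o ∈ insertNone (minima p), ∀ o' ∈ insertNone (minima p),
      attach p o = attach p o' → ∀ b ∈ o, b ∈ o' := by
    intro o ho o' ho' h b hb
    rw [mem_insertNone] at ho ho'
    obtain ⟨b', hb', hp⟩ := (part_attach_zero_succ p o' b).1
      (h ▸ (part_attach_zero_succ p o b).2 ⟨b, hb, rfl⟩)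
    rwa [eq_of_mem_minima (ho b hb) (ho' b' hb') hp.symm]
  intro o ho o' ho' h
  exact Option.ext fun b => ⟨key o ho o' ho' h b, key o' ho' o ho h.symm b⟩

/-- The embedding of pairs induced by the shift `i ↦ i + 1`. -/
def shift : Fin n × Fin n ↪ Fin (n + 1) × Fin (n + 1) :=
  (Fin.succEmb n).prodMap (Fin.succEmb n)

lemma shift_apply (e : Fin n × Fin n) : shift e = (e.1.succ, e.2.succ) := rfl

lemma zero_notMem_map_shift (s : Finset (Fin n × Fin n)) (j : Fin (n + 1)) :
    (0, j) ∉ s.map shift := by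
  simp [shift_apply, Fin.succ_ne_zero]

lemma isArc_attach_succ (p : SetPartition n) (o : Option (Fin n)) (i j : Fin n) :
    IsArc (attach p o) i.succ j.succ ↔ IsArc p i j := by
  simp [isArc_iff, Fin.forall_fin_succ]

lemma isArc_attach_zero {p : SetPartition n} {o : Option (Fin n)}
    (ho : o ∈ insertNone (minima p)) (j : Fin n) :
    IsArc (attach p o) 0 j.succ ↔ j ∈ o := by
  rw [mem_insertNone] at ho
  rw [isArc_iff]
  simp only [Fin.succ_pos, part_attach_zero_succ, true_and, Fin.forall_fin_succ, lt_self_iff_false,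
    false_imp_iff, Fin.succ_lt_succ_iff, forall_true_left, Ne, not_exists, not_and]
  constructor
  · rintro ⟨⟨b, hb, hbj⟩, h⟩
    have := mem_minima.1 (ho b hb)
    rcases lt_trichotomy j b with hjb | rfl | hjb
    · exact absurd hbj.symm (this j hjb)
    · exact hb
    · exact absurd rfl (h b hjb b hb)
  · intro hj
    refine ⟨⟨j, hj, rfl⟩, fun x hx b hb hbx => ?_⟩
    obtain rfl := Option.mem_unique hj hb
    exact mem_minima.1 (ho _ hj) x hx hbx.symm

lemma not_isArc_zero_right (p : SetPartition (n + 1)) (i : Fin (n + 1)) : ¬ IsArc p i 0 :=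
  fun h => Fin.not_lt_zero _ h.1

lemma arcs_attach_none (p : SetPartition n) :
    arcs (attach p none) = (arcs p).map shift := by
  ext ⟨x, y⟩
  cases x using Fin.cases <;> cases y using Fin.cases <;>
    simp [mem_arcs, not_isArc_zero_right, isArc_attach_zero, isArc_attach_succ, shift_apply,
      Fin.succ_ne_zero]

lemma arcs_attach_some {p : SetPartition n} {b : Fin n} (hb : b ∈ minima p) :
    arcs (attach p (some b)) =
      cons (0, b.succ) ((arcs p).map shift) (zero_notMem_map_shift _ _) := by
  have ho : some b ∈ insertNone (minima p) := by simpa using hb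
  ext ⟨x, y⟩
  cases x using Fin.cases <;> cases y using Fin.cases <;>
    simp [mem_arcs, not_isArc_zero_right, isArc_attach_zero ho, isArc_attach_succ, shift_apply,
      Fin.succ_ne_zero, (Fin.succ_ne_zero _).symm, eq_comm]

lemma minima_attach_none (p : SetPartition n) :
    minima (attach p none) = cons 0 ((minima p).map (Fin.succEmb n)) (by simp) := by
  ext x
  cases x using Fin.cases <;>
    simp [mem_minima, Fin.forall_fin_succ, Fin.succ_ne_zero]

lemma minima_attach_some {p : SetPartition n} {b : Fin n} (hb : b ∈ minima p) :
    minima (attach p (some b)) =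
      cons 0 (((minima p).erase b).map (Fin.succEmb n)) (by simp) := by
  ext x
  cases x using Fin.cases with
  | zero => simp [mem_minima]
  | succ i =>
    simp only [mem_minima, Fin.forall_fin_succ, mem_cons, Fin.succ_ne_zero, mem_map, mem_erase,
      false_or, Fin.coe_succEmb, Fin.succ_inj, exists_eq_right, Fin.succ_pos, forall_true_left,
      Ne, part_attach_zero_succ, part_attach_succ, Fin.succ_lt_succ_iff, Option.mem_some_iff,
      exists_eq_left']
    refine and_congr_left fun hi => not_congr ⟨fun h => ?_, fun h => h ▸ rfl⟩
    exact (eq_of_mem_minima hb (mem_minima.2 hi) h).symm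

lemma arcsFrom_zero (p : SetPartition (n + 1)) : arcsFrom p 0 = #(arcs p) := by
  simp [arcsFrom]

lemma arcsFrom_attach_succ {p : SetPartition n} {o : Option (Fin n)}
    (ho : o ∈ insertNone (minima p)) (i : Fin n) :
    arcsFrom (attach p o) i.succ = arcsFrom p i := by
  cases o with
  | none =>
    simp [arcsFrom, arcs_attach_none, filter_map, Function.comp_def, shift_apply]
  | some b =>
    simp [arcsFrom, arcs_attach_some (mem_insertNone.1 ho b rfl), filter_cons, filter_map,
      Function.comp_def, shift_apply, -cons_eq_insert]

/-- The two arcs are listed with increasing left endpoints and form an alignment. -/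
def Aligned (e : (Fin n × Fin n) × (Fin n × Fin n)) : Prop :=
  e.1.1 < e.2.1 ∧ ¬ Crossing e.1 e.2 ∧ ¬ Crossing e.2 e.1 ∧ ¬ Nesting e.1 e.2 ∧
    ¬ Nesting e.2 e.1

open Classical in
lemma al_eq (p : SetPartition n) : al p = ∑ a ∈ arcs p, #{b ∈ arcs p | Aligned (a, b)} := by
  simp_rw [card_filter]
  rw [← sum_product', ← card_filter, al, ← Set.ncard_coe_finset]
  congr 1
  ext ⟨a, b⟩
  rw [mem_coe, mem_filter, mem_product, mem_arcs, mem_arcs, and_assoc]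
  rfl

lemma aligned_shift (a b : Fin n × Fin n) : Aligned (shift a, shift b) ↔ Aligned (a, b) := by
  simp [Aligned, Crossing, Nesting, shift_apply]

lemma not_aligned_zero (a : Fin (n + 1) × Fin (n + 1)) (j : Fin (n + 1)) :
    ¬ Aligned (a, (0, j)) :=
  fun h => Fin.not_lt_zero _ h.1

lemma aligned_zero_iff {p : SetPartition n} {b : Fin n} (hb : b ∈ minima p) {e : Fin n × Fin n}
    (he : e ∈ arcs p) : Aligned ((0, b.succ), shift e) ↔ b ≤ e.1 := by
  obtain ⟨hlt, hp, -⟩ := (isArc_iff p _ _).1 (mem_arcs.1 he)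
  have hne : b ≠ e.2 := by
    rintro rfl
    exact mem_minima.1 hb e.1 hlt hp
  simp [Aligned, Crossing, Nesting, shift_apply]
  omega

lemma al_attach_none (p : SetPartition n) : al (attach p none) = al p := by
  classical
  rw [al_eq, al_eq, arcs_attach_none]
  simp only [filter_map, card_map, sum_map, Function.comp_def, aligned_shift]

lemma al_attach_some {p : SetPartition n} {b : Fin n} (hb : b ∈ minima p) :
    al (attach p (some b)) = al p + arcsFrom p b := by
  classical
  rw [al_eq, al_eq, arcs_attach_some hb, arcsFrom, add_comm (∑ _ ∈ _, _)]
  simp only [sum_cons, filter_cons, not_aligned_zero, if_false, filter_map, card_map, sum_map,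
    Function.comp_def, aligned_shift]
  congr 2
  exact filter_congr fun e he => aligned_zero_iff hb he

lemma profile_attach_none (p : SetPartition n) :
    profile (attach p none) =
      (#(arcs p), al p, #(arcs p) ::ₘ (minima p).val.map (arcsFrom p)) := by
  simp [profile, al_attach_none, minima_attach_none, arcsFrom_zero, arcs_attach_none,
    arcsFrom_attach_succ]

lemma profile_attach_some {p : SetPartition n} {b : Fin n} (hb : b ∈ minima p) :
    profile (attach p (some b)) =
      (#(arcs p) + 1, al p + arcsFrom p b,
        (#(arcs p) + 1) ::ₘ ((minima p).val.map (arcsFrom p)).erase (arcsFrom p b)) := by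
  rw [← Multiset.map_erase_of_mem _ _ hb]
  have ho : some b ∈ insertNone (minima p) := by simpa using hb
  simp [profile, al_attach_some hb, minima_attach_some hb, arcsFrom_zero, arcs_attach_some hb,
    arcsFrom_attach_succ ho, -cons_eq_insert, -map_erase]

/-- The children of `p`. -/
noncomputable def children (p : SetPartition n) : Finset (SetPartition (n + 1)) :=
  open Classical in (insertNone (minima p)).image (attach p)

lemma mem_children {p : SetPartition n} {c : SetPartition (n + 1)} :
    c ∈ children p ↔ IsChild c p := by
  simp only [children, mem_image, isChild_iff]

lemma map_profile_children (p : SetPartition n) :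
    (children p).val.map profile = nextProfiles (profile p) := by
  classical
  rw [children, image_val_of_injOn (attach_injOn p), Multiset.map_map]
  change Multiset.map _ (none ::ₘ (minima p).val.map some) = _
  rw [Multiset.map_cons, Multiset.map_map, Function.comp_apply, profile_attach_none, nextProfiles,
    profile, Multiset.map_map]
  congr 1
  exact Multiset.map_congr rfl fun b hb => profile_attach_some hb

lemma eq_of_isChild {p q : SetPartition n} {c : SetPartition (n + 1)} (hp : IsChild c p)
    (hq : IsChild c q) : p = q :=
  ext_part fun i j => by
    rw [← inSameBlock_iff, ← inSameBlock_iff, hp i j, hq i j]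

/-- The profiles of the partitions in `level p l`, where `p` has profile `s`. -/
def levelProfiles (s : ℕ × ℕ × Multiset ℕ) : ℕ → Multiset (ℕ × ℕ × Multiset ℕ)
  | 0 => {s}
  | l + 1 => (levelProfiles s l).bind nextProfiles

lemma exists_level_eq (p : SetPartition n) (l : ℕ) :
    ∃ L : Finset (SetPartition (n + l)), level p l = L ∧
      L.val.map profile = levelProfiles (profile p) l := by
  induction l with
  | zero => exact ⟨{p}, by simp [level], by simp [levelProfiles]⟩
  | succ l ih =>
    obtain ⟨L, hL, hS⟩ := ih
    have hd : (L : Set (SetPartition (n + l))).PairwiseDisjoint children :=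
      fun q _ r _ hqr => disjoint_left.2 fun c hq hr =>
        hqr (eq_of_isChild (mem_children.1 hq) (mem_children.1 hr))
    refine ⟨(L.disjiUnion children hd : Finset (SetPartition (n + l + 1))), ?_, ?_⟩
    · change {c : SetPartition (n + l + 1) | ∃ q ∈ level p l, IsChild c q} = _
      ext c
      change _ ↔ c ∈ L.disjiUnion children hd
      simp [hL, mem_children]
    · change Multiset.map (profile (n := n + l + 1)) (L.disjiUnion children hd).val = _
      rw [levelProfiles, ← hS, disjiUnion_val, Multiset.map_bind, Multiset.bind_map]
      exact Multiset.bind_congr fun q _ => map_profile_children q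

lemma ncard_level_eq (p : SetPartition n) (l : ℕ) (P : ℕ × ℕ × Multiset ℕ → Prop)
    [DecidablePred P] :
    {t ∈ level p l | P (profile t)}.ncard =
      (levelProfiles (profile p) l).countP P := by
  obtain ⟨L, hL, hS⟩ := exists_level_eq p l
  rw [← hS, Multiset.countP_map, hL, ← filter_val, card_val, ← Set.ncard_coe_finset]
  simp

lemma al_count (p : SetPartition n) (l c : ℕ) :
    {t ∈ level p l | al t = c}.ncard =
      ((levelProfiles (profile p) l).map fun s => s.2.1).count c := by
  rw [Multiset.count_map]
  simp_rw [eq_comm (a := c)]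
  rw [← Multiset.countP_eq_card_filter, ← ncard_level_eq p l fun s => s.2.1 = c]
  rfl

lemma profile_eq_of_al {p q : SetPartition n}
    (h : ∀ l ≤ 1, ∀ c : ℕ,
      {t ∈ level p l | al t = c}.ncard = {t ∈ level q l | al t = c}.ncard) :
    profile p = profile q := by
  simp only [al_count] at h
  have h0 := Multiset.ext.2 (h 0 zero_le_one)
  have h1 := Multiset.ext.2 (h 1 le_rfl)
  have hal : al p = al q := by simpa [levelProfiles, profile] using h0
  have hM : (minima p).val.map (arcsFrom p) = (minima q).val.map (arcsFrom q) := by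
    simp only [levelProfiles, Multiset.singleton_bind, nextProfiles, profile,
      Multiset.map_cons, Multiset.map_map, hal, Multiset.cons_inj_right] at h1
    refine Multiset.map_injective (add_right_injective (al q)) ?_
    simpa [Function.comp_def] using h1
  rw [profile, profile, card_arcs, card_arcs, hal, hM]

end SetPartition

/-- Corollary 3.3. Let `lam` and `pi` be partitions of `[n]`, both with
exactly `k` blocks. If the multiset of values of `al` agrees on levels `0` and `1` of the
trees rooted at `lam` and `pi`, then it agrees on `T(lam,l,m)` and `T(pi,l,m)` for all
`l, m ≥ 0`. Multiset equality is expressed by equality of the number of elements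
attaining each value `c : ℕ`. -/
theorem statement9 {n k : ℕ} (lam pi : SetPartition n)
    (hlam : lam.parts.card = k) (hpi : pi.parts.card = k)
    (h : ∀ l ≤ 1, ∀ c : ℕ,
      {t ∈ level lam l | al t = c}.ncard =
      {t ∈ level pi l | al t = c}.ncard) :
    ∀ l m : ℕ, ∀ c : ℕ,
      {t ∈ level lam l | t.parts.card = m ∧ al t = c}.ncard =
      {t ∈ level pi l | t.parts.card = m ∧ al t = c}.ncard := by
  intro l m c
  have key : ∀ p : SetPartition n, {t ∈ level p l | t.parts.card = m ∧ al t = c}.ncard =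
      (SetPartition.levelProfiles (SetPartition.profile p) l).countP
        fun s => Multiset.card s.2.2 = m ∧ s.2.1 = c := by
    intro p
    rw [← SetPartition.ncard_level_eq]
    simp [SetPartition.profile, SetPartition.card_minima]
  rw [key, key, SetPartition.profile_eq_of_al h]
end

section
/- For n ≥ 1 and partitions λ and π of [n], λ ∼_ne π if and only if ne(λ) = ne(π) and neseq(λ) = neseq(π) as sequences. -/
open Finset

/-- The minimum of a block, as a natural number (`0` for the empty set). -/
noncomputable def minOfBlock {n : ℕ} (B : Finset (Fin n)) : ℕ :=
  sInf (Fin.val '' (B : Set (Fin n)))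

/-- `u(p, b)`: the number of arcs `(x, y)` of `p` with `x < b < y` (values in `ℕ`). -/
noncomputable def uStat {n : ℕ} (p : SetPartition n) (b : ℕ) : ℕ :=
  {e : Fin n × Fin n | IsArc p e.1 e.2 ∧ (e.1 : ℕ) < b ∧ b < (e.2 : ℕ)}.ncard

/-- `v(p, b)`: the number of arcs `(x, y)` of `p` with `x < y < b` (values in `ℕ`). -/
noncomputable def vStat {n : ℕ} (p : SetPartition n) (b : ℕ) : ℕ :=
  {e : Fin n × Fin n | IsArc p e.1 e.2 ∧ (e.2 : ℕ) < b}.ncard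

/-- `crset p`: the multiset `{u₁(p), …, u_k(p)}`, where `u_i(p)` is the number of arcs
passing over the minimum `b_i` of the `i`-th block. -/
noncomputable def crset {n : ℕ} (p : SetPartition n) : Multiset ℕ :=
  p.parts.val.map fun B => uStat p (minOfBlock B)

/-- `neseq p`: the sequence `(v₁(p), …, v_k(p))`, where `v_i(p)` is the number of arcs
lying entirely to the left of the minimum `b_i` of the `i`-th block, blocks being ordered
by increasing minima. -/
noncomputable def neseq {n : ℕ} (p : SetPartition n) : List ℕ :=
  ((p.parts.image fun B => minOfBlock B).sort (· ≤ ·)).map fun b => vStat p b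

/-- `p ∼_cr q`: the statistic `cr` has the same distribution on `T(p,l,m)` and `T(q,l,m)`
for all `l, m ≥ 0` (multiset equality expressed by counting, for each value `c`, the
partitions attaining it). -/
def SimCr {n : ℕ} (p q : SetPartition n) : Prop :=
  ∀ l m c : ℕ,
    {t ∈ level p l | t.parts.card = m ∧ cr t = c}.ncard =
    {t ∈ level q l | t.parts.card = m ∧ cr t = c}.ncard

/-- `p ∼_ne q`: the statistic `ne` has the same distribution on `T(p,l,m)` and `T(q,l,m)`
for all `l, m ≥ 0`. -/
def SimNe {n : ℕ} (p q : SetPartition n) : Prop :=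
  ∀ l m c : ℕ,
    {t ∈ level p l | t.parts.card = m ∧ ne' t = c}.ncard =
    {t ∈ level q l | t.parts.card = m ∧ ne' t = c}.ncard

/-- `∼_cr` as a setoid on `Π_{n,k}`, the partitions of `[n]` with exactly `k` blocks. -/
def crSetoid (n k : ℕ) : Setoid {p : SetPartition n // p.parts.card = k} :=
  ⟨fun p q => SimCr p.1 q.1,
    ⟨fun _ _ _ _ => rfl, fun h l m c => (h l m c).symm,
      fun h₁ h₂ l m c => (h₁ l m c).trans (h₂ l m c)⟩⟩

/-- `∼_ne` as a setoid on `Π_{n,k}`, the partitions of `[n]` with exactly `k` blocks. -/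
def neSetoid (n k : ℕ) : Setoid {p : SetPartition n // p.parts.card = k} :=
  ⟨fun p q => SimNe p.1 q.1,
    ⟨fun _ _ _ _ => rfl, fun h l m c => (h l m c).symm,
      fun h₁ h₂ l m c => (h₁ l m c).trans (h₂ l m c)⟩⟩

/-- `∼_ne` as a setoid on all of `Π_n`. -/
def neSetoidAll (n : ℕ) : Setoid (SetPartition n) :=
  ⟨SimNe,
    ⟨fun _ _ _ _ => rfl, fun h l m c => (h l m c).symm,
      fun h₁ h₂ l m c => (h₁ l m c).trans (h₂ l m c)⟩⟩

section InSameBlock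

variable {n : ℕ} (p : SetPartition n)

lemma inSameBlock_iff_part_eq {i j : Fin n} : InSameBlock p i j ↔ p.part i = p.part j := by
  rw [← p.mem_part_iff_part_eq_part (mem_univ i) (mem_univ j), p.mem_part_iff_exists]
  rfl

lemma inSameBlock_refl (i : Fin n) : InSameBlock p i i :=
  (inSameBlock_iff_part_eq p).2 rfl

variable {p}

lemma InSameBlock.symm {i j : Fin n} (h : InSameBlock p i j) : InSameBlock p j i := by
  rw [inSameBlock_iff_part_eq] at *
  exact h.symm

lemma InSameBlock.trans {i j k : Fin n} (h : InSameBlock p i j) (h' : InSameBlock p j k) :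
    InSameBlock p i k := by
  rw [inSameBlock_iff_part_eq] at *
  exact h.trans h'

lemma inSameBlock_iff_mem {B : Finset (Fin n)} (hB : B ∈ p.parts) {i j : Fin n} (hi : i ∈ B) :
    InSameBlock p i j ↔ j ∈ B := by
  rw [inSameBlock_iff_part_eq, p.part_eq_of_mem hB hi, eq_comm, p.part_eq_iff_mem hB]

lemma inSameBlock_ext {q : SetPartition n}
    (h : ∀ i j, InSameBlock p i j ↔ InSameBlock q i j) : p = q := by
  have key : ∀ p q : SetPartition n, (∀ i j, InSameBlock p i j ↔ InSameBlock q i j) →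
      p.parts ⊆ q.parts := by
    intro p q h B hB
    obtain ⟨i, hi⟩ := p.nonempty_of_mem_parts hB
    obtain ⟨C, hC, hiC⟩ := q.exists_mem (mem_univ i)
    have : B = C := by
      ext j
      rw [← inSameBlock_iff_mem hB hi, h, inSameBlock_iff_mem hC hiC]
    exact this ▸ hC
  exact Finpartition.ext ((key p q h).antisymm (key q p fun i j => (h i j).symm))

lemma isArc_iff {i j : Fin n} :
    IsArc p i j ↔ i < j ∧ InSameBlock p i j ∧ ∀ x, InSameBlock p i x → ¬ (i < x ∧ x < j) := by
  constructor
  · rintro ⟨h, B, hB, hi, hj, hx⟩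
    exact ⟨h, ⟨B, hB, hi, hj⟩, fun x hix => hx x ((inSameBlock_iff_mem hB hi).1 hix)⟩
  · rintro ⟨h, ⟨B, hB, hi, hj⟩, hx⟩
    exact ⟨h, B, hB, hi, hj, fun x hxB => hx x ((inSameBlock_iff_mem hB hi).2 hxB)⟩

end InSameBlock

section BlockMinima

variable {n : ℕ}

open Classical in
/-- The set of minimal elements of the blocks of `p`. -/
noncomputable def blockMinima (p : SetPartition n) : Finset (Fin n) :=
  univ.filter fun b => ∀ x, InSameBlock p b x → b ≤ x

lemma mem_blockMinima {p : SetPartition n} {b : Fin n} :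
    b ∈ blockMinima p ↔ ∀ x, InSameBlock p b x → b ≤ x := by
  simp [blockMinima]

lemma eq_of_mem_blockMinima {p : SetPartition n} {b c : Fin n} (hb : b ∈ blockMinima p)
    (hc : c ∈ blockMinima p) (h : InSameBlock p b c) : b = c :=
  le_antisymm (mem_blockMinima.1 hb c h) (mem_blockMinima.1 hc b h.symm)

lemma exists_minOfBlock_eq {p : SetPartition n} {B : Finset (Fin n)} (hB : B ∈ p.parts) :
    ∃ b ∈ B, b ∈ blockMinima p ∧ minOfBlock B = b := by
  have hne : (Fin.val '' (B : Set (Fin n))).Nonempty := by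
    simpa using p.nonempty_of_mem_parts hB
  obtain ⟨b, hb, hbm⟩ := Nat.sInf_mem hne
  refine ⟨b, hb, mem_blockMinima.2 fun x hx => ?_, hbm.symm⟩
  have hxB := (inSameBlock_iff_mem hB hb).1 hx
  rw [Fin.le_def, hbm]
  exact Nat.sInf_le ⟨x, hxB, rfl⟩

lemma image_minOfBlock_parts (p : SetPartition n) :
    p.parts.image (fun B => minOfBlock B) = (blockMinima p).image Fin.val := by
  ext m
  simp only [mem_image]
  constructor
  · rintro ⟨B, hB, rfl⟩
    obtain ⟨b, -, hb, h⟩ := exists_minOfBlock_eq hB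
    exact ⟨b, hb, h.symm⟩
  · rintro ⟨b, hb, rfl⟩
    obtain ⟨B, hB, hbB⟩ := p.exists_mem (mem_univ b)
    obtain ⟨c, hcB, hc, h⟩ := exists_minOfBlock_eq hB
    refine ⟨B, hB, ?_⟩
    rw [h, eq_of_mem_blockMinima hb hc ⟨B, hB, hbB, hcB⟩]

lemma card_blockMinima (p : SetPartition n) : #(blockMinima p) = #p.parts := by
  rw [← card_image_of_injective _ Fin.val_injective, ← image_minOfBlock_parts]
  refine card_image_of_injOn fun B hB C hC h => ?_
  obtain ⟨b, hbB, -, hb⟩ := exists_minOfBlock_eq hB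
  obtain ⟨c, hcC, -, hc⟩ := exists_minOfBlock_eq hC
  have : b = c := Fin.ext (hb.symm.trans (h.trans hc))
  exact p.eq_of_mem_parts hB hC hbB (this ▸ hcC)

lemma IsArc.left_eq {p : SetPartition n} {x x' y : Fin n} (h : IsArc p x y) (h' : IsArc p x' y) :
    x = x' := by
  rw [isArc_iff] at h h'
  have hxx := h.2.1.trans h'.2.1.symm
  rcases lt_trichotomy x x' with hlt | heq | hgt
  · exact absurd ⟨hlt, h'.1⟩ (h.2.2 x' hxx)
  · exact heq
  · exact absurd ⟨hgt, h.1⟩ (h'.2.2 x hxx.symm)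

lemma exists_isArc_iff {p : SetPartition n} {y : Fin n} :
    (∃ x, IsArc p x y) ↔ y ∉ blockMinima p := by
  classical
  simp only [mem_blockMinima, not_forall, not_le]
  constructor
  · rintro ⟨x, hx⟩
    rw [isArc_iff] at hx
    exact ⟨x, hx.2.1.symm, hx.1⟩
  · rintro ⟨x, hx, hxy⟩
    obtain ⟨m, hm, hmax⟩ := (univ.filter fun x => InSameBlock p y x ∧ x < y).exists_max_image id
      ⟨x, by simp [hx, hxy]⟩
    simp only [mem_filter, mem_univ, true_and, id] at hm hmax
    refine ⟨m, isArc_iff.2 ⟨hm.2, hm.1.symm, fun z hz hmz => ?_⟩⟩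
    exact absurd (hmax z ⟨hm.1.trans hz, hmz.2⟩) (not_le.2 hmz.1)

/-- The number of elements of `Fin n` that are smaller than `b` and do not belong to `S`. -/
def countNotMemBelow (S : Finset (Fin n)) (b : ℕ) : ℕ :=
  #(univ.filter fun y : Fin n => (y : ℕ) < b ∧ y ∉ S)

lemma vStat_eq (p : SetPartition n) (b : ℕ) : vStat p b = countNotMemBelow (blockMinima p) b := by
  have himg : Prod.snd '' {e : Fin n × Fin n | IsArc p e.1 e.2 ∧ (e.2 : ℕ) < b} =
      ↑(univ.filter fun y : Fin n => (y : ℕ) < b ∧ y ∉ blockMinima p) := by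
    ext y
    simp [← exists_isArc_iff, and_comm]
  rw [vStat, countNotMemBelow, ← Set.ncard_coe_finset, ← himg, Set.InjOn.ncard_image]
  rintro ⟨x, y⟩ h ⟨x', y'⟩ h' (rfl : y = y')
  exact Prod.ext (IsArc.left_eq h.1 h'.1) rfl

lemma countNotMemBelow_mono (S : Finset (Fin n)) : Monotone (countNotMemBelow S) := by
  intro a b hab
  refine card_le_card fun y => ?_
  simp only [mem_filter, mem_univ, true_and]
  exact fun h => ⟨h.1.trans_le hab, h.2⟩

lemma countNotMemBelow_add (S : Finset (Fin n)) (b : Fin n) :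
    countNotMemBelow S b + #((S.image Fin.val).filter (· < (b : ℕ))) = b := by
  have h : #((S.image Fin.val).filter (· < (b : ℕ))) = #((Iio b).filter (· ∈ S)) := by
    rw [filter_image, card_image_of_injective _ Fin.val_injective]
    congr 1
    ext y
    simp [and_comm]
  have h' : countNotMemBelow S b = #((Iio b).filter (· ∉ S)) := by
    rw [countNotMemBelow]
    congr 1
    ext y
    simp
  rw [h, h', add_comm, card_filter_add_card_filter_not, Fin.card_Iio]

/-- The sequence `neseq` expressed through the set of block minima. -/
noncomputable def countSeq (S : Finset (Fin n)) : List ℕ :=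
  ((S.image Fin.val).sort (· ≤ ·)).map (countNotMemBelow S)

lemma neseq_eq (p : SetPartition n) : neseq p = countSeq (blockMinima p) := by
  rw [neseq, image_minOfBlock_parts, countSeq]
  exact List.map_congr_left fun b _ => vStat_eq p b

lemma coe_countSeq (S : Finset (Fin n)) :
    (countSeq S : Multiset ℕ) = S.val.map fun b : Fin n => countNotMemBelow S b := by
  rw [countSeq, ← Multiset.map_coe, sort_eq, image_val_of_injOn Fin.val_injective.injOn,
    Multiset.map_map]
  rfl

lemma pairwise_countSeq (S : Finset (Fin n)) : (countSeq S).Pairwise (· ≤ ·) :=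
  (pairwise_sort _ _).map _ fun _ _ h => countNotMemBelow_mono S h

lemma card_filter_lt_orderEmbOfFin {s : Finset ℕ} {k : ℕ} (h : #s = k) (i : Fin k) :
    #(s.filter (· < s.orderEmbOfFin h i)) = i := by
  have : s.filter (· < s.orderEmbOfFin h i) = (Iio i).image (s.orderEmbOfFin h) := by
    ext x
    simp only [mem_filter, mem_image, mem_Iio]
    constructor
    · rintro ⟨hx, hlt⟩
      have hr : x ∈ Set.range (s.orderEmbOfFin h) := by
        rw [range_orderEmbOfFin]
        exact hx
      obtain ⟨j, rfl⟩ := hr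
      exact ⟨j, by simpa using hlt, rfl⟩
    · rintro ⟨j, hj, rfl⟩
      exact ⟨orderEmbOfFin_mem s h j, by simpa using hj⟩
  rw [this, card_image_of_injective _ (s.orderEmbOfFin h).injective, Fin.card_Iio]

lemma countSeq_injective : Function.Injective (countSeq (n := n)) := by
  intro S T h
  apply image_injective Fin.val_injective
  have hlen : #(S.image Fin.val) = #(T.image Fin.val) := by
    simpa [countSeq] using congrArg List.length h
  have key : ∀ (U : Finset (Fin n)) (k : ℕ) (hk : #(U.image Fin.val) = k) (i : Fin k),
      (countSeq U)[(i : ℕ)]? = some (countNotMemBelow U ((U.image Fin.val).orderEmbOfFin hk i)) ∧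
      countNotMemBelow U ((U.image Fin.val).orderEmbOfFin hk i) + i =
        (U.image Fin.val).orderEmbOfFin hk i := by
    intro U k hk i
    constructor
    · rw [countSeq, List.getElem?_map, orderEmbOfFin_apply, List.getElem?_eq_getElem]
      rfl
    · obtain ⟨b, -, hb⟩ := mem_image.1 (orderEmbOfFin_mem (U.image Fin.val) hk i)
      have := countNotMemBelow_add U b
      rwa [hb, card_filter_lt_orderEmbOfFin] at this
  have heq : ∀ i, (S.image Fin.val).orderEmbOfFin rfl i =
      (T.image Fin.val).orderEmbOfFin hlen.symm i := by
    intro i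
    obtain ⟨h₁, h₂⟩ := key S _ rfl i
    obtain ⟨h₃, h₄⟩ := key T _ hlen.symm i
    rw [h, h₃, Option.some_inj] at h₁
    rw [← h₂, ← h₄, h₁]
  have := (range_orderEmbOfFin (S.image Fin.val) rfl).symm.trans
    ((congrArg Set.range (funext heq)).trans (range_orderEmbOfFin (T.image Fin.val) hlen.symm))
  exact_mod_cast this

end BlockMinima

section Children

variable {n : ℕ}

open Classical in
/-- The partition of `Fin (n + 1)` obtained from `p` by shifting its elements up by one and adding
the element `0`, as a singleton for `none` and to the block of `b` for `some b`. -/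
noncomputable def addZero (p : SetPartition n) (o : Option (Fin n)) : SetPartition (n + 1) :=
  Finpartition.ofSetoid <| Setoid.ker
    (Fin.cons (o.map p.part) (fun i => some (p.part i)) : Fin (n + 1) → Option (Finset (Fin n)))

lemma inSameBlock_addZero (p : SetPartition n) (o : Option (Fin n)) (i j : Fin (n + 1)) :
    InSameBlock (addZero p o) i j ↔
      (Fin.cons (o.map p.part) (fun i => some (p.part i)) : Fin (n + 1) → Option (Finset (Fin n))) i
        = (Fin.cons (o.map p.part) (fun i => some (p.part i)) :
          Fin (n + 1) → Option (Finset (Fin n))) j := by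
  classical
  rw [inSameBlock_iff_part_eq, eq_comm,
    ← Finpartition.mem_part_iff_part_eq_part _ (mem_univ j) (mem_univ i), addZero,
    Finpartition.mem_part_ofSetoid_iff_rel]
  rfl

lemma inSameBlock_addZero_succ (p : SetPartition n) (o : Option (Fin n)) (i j : Fin n) :
    InSameBlock (addZero p o) i.succ j.succ ↔ InSameBlock p i j := by
  rw [inSameBlock_addZero, inSameBlock_iff_part_eq]
  simp

lemma inSameBlock_addZero_zero (p : SetPartition n) (o : Option (Fin n)) (j : Fin n) :
    InSameBlock (addZero p o) 0 j.succ ↔ ∃ b ∈ o, InSameBlock p b j := by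
  rw [inSameBlock_addZero]
  cases o <;> simp [inSameBlock_iff_part_eq]

lemma inSameBlock_addZero_zero_iff {p : SetPartition n} {o : Option (Fin n)}
    (ho : o ∈ insertNone (blockMinima p)) {j : Fin n} (hj : j ∈ blockMinima p) :
    InSameBlock (addZero p o) 0 j.succ ↔ o = some j := by
  rw [inSameBlock_addZero_zero]
  constructor
  · rintro ⟨b, hb, h⟩
    rwa [← eq_of_mem_blockMinima (mem_insertNone.1 ho b hb) hj h]
  · exact fun h => ⟨j, h, inSameBlock_refl p j⟩

lemma isArc_addZero_succ (p : SetPartition n) (o : Option (Fin n)) (i j : Fin n) :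
    IsArc (addZero p o) i.succ j.succ ↔ IsArc p i j := by
  simp [isArc_iff, inSameBlock_addZero_succ, Fin.forall_fin_succ]

lemma isArc_addZero_zero {p : SetPartition n} {o : Option (Fin n)}
    (ho : o ∈ insertNone (blockMinima p)) (j : Fin n) :
    IsArc (addZero p o) 0 j.succ ↔ o = some j := by
  simp only [isArc_iff, inSameBlock_addZero_zero, Fin.forall_fin_succ, Fin.succ_pos, true_and,
    lt_irrefl, false_and, not_false_eq_true, implies_true, Fin.succ_lt_succ_iff, not_lt]
  constructor
  · rintro ⟨⟨b, hb, hbj⟩, h⟩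
    have := h b ⟨b, hb, inSameBlock_refl p b⟩
    rwa [le_antisymm this (mem_blockMinima.1 (mem_insertNone.1 ho b hb) j hbj)]
  · rintro rfl
    refine ⟨⟨j, rfl, inSameBlock_refl p j⟩, ?_⟩
    rintro x ⟨b, hb, hx⟩
    cases hb
    exact mem_blockMinima.1 (mem_insertNone.1 ho j rfl) x hx

open Classical in
/-- The effect of `addZero` on the number of nestings and the set of block minima. -/
noncomputable def addZeroData (d : ℕ × Finset (Fin n)) (o : Option (Fin n)) :
    ℕ × Finset (Fin (n + 1)) :=
  (d.1 + o.elim 0 (fun b => countNotMemBelow d.2 b),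
    insert 0 ((d.2.filter fun b => o ≠ some b).map (Fin.succEmb n)))

lemma blockMinima_addZero {p : SetPartition n} {o : Option (Fin n)}
    (ho : o ∈ insertNone (blockMinima p)) (m : ℕ) :
    blockMinima (addZero p o) = (addZeroData (m, blockMinima p) o).2 := by
  classical
  have hmin : ∀ j : Fin n, j.succ ∈ blockMinima (addZero p o) ↔
      ¬ InSameBlock (addZero p o) 0 j.succ ∧ j ∈ blockMinima p := by
    intro j
    simp only [mem_blockMinima, Fin.forall_fin_succ, inSameBlock_addZero_succ,
      Fin.succ_le_succ_iff]
    refine and_congr_left fun _ => ?_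
    rw [show (j.succ ≤ 0) ↔ False by simp, imp_false]
    exact not_congr ⟨InSameBlock.symm, InSameBlock.symm⟩
  ext j
  refine Fin.cases ?_ (fun j => ?_) j
  · simp [addZeroData, mem_blockMinima]
  · rw [hmin]
    by_cases hj : j ∈ blockMinima p
    · rw [inSameBlock_addZero_zero_iff ho hj]
      simp [addZeroData, hj]
    · simp [addZeroData, hj]

lemma ne'_addZero {p : SetPartition n} {o : Option (Fin n)}
    (ho : o ∈ insertNone (blockMinima p)) :
    ne' (addZero p o) = (addZeroData (ne' p, blockMinima p) o).1 := by
  classical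
  set f : (Fin n × Fin n) × (Fin n × Fin n) →
      (Fin (n + 1) × Fin (n + 1)) × (Fin (n + 1) × Fin (n + 1)) :=
    fun e => ((e.1.1.succ, e.1.2.succ), (e.2.1.succ, e.2.2.succ)) with hf
  set g : Fin n × (Fin n × Fin n) →
      (Fin (n + 1) × Fin (n + 1)) × (Fin (n + 1) × Fin (n + 1)) :=
    fun e => ((0, e.1.succ), (e.2.1.succ, e.2.2.succ)) with hg
  have hfinj : Function.Injective f := by
    rintro ⟨⟨a, b⟩, c, d⟩ ⟨⟨a', b'⟩, c', d'⟩ h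
    simpa [hf] using h
  have hginj : Function.Injective g := by
    rintro ⟨a, b, c⟩ ⟨a', b', c'⟩ h
    simpa [hg] using h
  set A := {e : (Fin n × Fin n) × (Fin n × Fin n) |
    IsArc p e.1.1 e.1.2 ∧ IsArc p e.2.1 e.2.2 ∧ Nesting e.1 e.2} with hA
  set B := {e : Fin n × (Fin n × Fin n) |
    o = some e.1 ∧ IsArc p e.2.1 e.2.2 ∧ e.2.2 < e.1} with hB
  have hunion : {e : (Fin (n + 1) × Fin (n + 1)) × (Fin (n + 1) × Fin (n + 1)) |
      IsArc (addZero p o) e.1.1 e.1.2 ∧ IsArc (addZero p o) e.2.1 e.2.2 ∧ Nesting e.1 e.2} =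
      f '' A ∪ g '' B := by
    ext ⟨⟨a, b⟩, c, d⟩
    simp only [Set.mem_ofPred_eq, Set.mem_union, Set.mem_image, hA, hB, hf, hg, Prod.exists,
      Prod.mk.injEq]
    constructor
    · rintro ⟨h₁, h₂, h₃, h₄, h₅⟩
      dsimp only at h₃ h₄ h₅
      obtain ⟨b, rfl⟩ := Fin.exists_succ_eq.2 (Fin.ne_zero_of_lt h₁.1)
      obtain ⟨c, rfl⟩ := Fin.exists_succ_eq.2 (Fin.ne_zero_of_lt h₃)
      obtain ⟨d, rfl⟩ := Fin.exists_succ_eq.2 (Fin.ne_zero_of_lt h₂.1)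
      rw [isArc_addZero_succ] at h₂
      rw [Fin.succ_lt_succ_iff] at h₄ h₅
      rcases Fin.eq_zero_or_eq_succ a with rfl | ⟨a, rfl⟩
      · rw [isArc_addZero_zero ho] at h₁
        exact Or.inr ⟨b, c, d, ⟨h₁, h₂, h₅⟩, by simp⟩
      · rw [isArc_addZero_succ] at h₁
        rw [Fin.succ_lt_succ_iff] at h₃
        exact Or.inl ⟨a, b, c, d, ⟨h₁, h₂, h₃, h₄, h₅⟩, by simp⟩
    · rintro (⟨a, b, c, d, ⟨h₁, h₂, h₃, h₄, h₅⟩, ⟨rfl, rfl⟩, rfl, rfl⟩ |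
        ⟨b, c, d, ⟨h₁, h₂, h₃⟩, ⟨rfl, rfl⟩, rfl, rfl⟩)
      · refine ⟨(isArc_addZero_succ p o _ _).2 h₁, (isArc_addZero_succ p o _ _).2 h₂, ?_⟩
        exact ⟨Fin.succ_lt_succ_iff.2 h₃, Fin.succ_lt_succ_iff.2 h₄, Fin.succ_lt_succ_iff.2 h₅⟩
      · refine ⟨(isArc_addZero_zero ho _).2 h₁, (isArc_addZero_succ p o _ _).2 h₂, ?_⟩
        exact ⟨Fin.succ_pos _, Fin.succ_lt_succ_iff.2 h₂.1, Fin.succ_lt_succ_iff.2 h₃⟩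
  have hdisj : Disjoint (f '' A) (g '' B) := by
    rw [Set.disjoint_left]
    rintro _ ⟨e, -, rfl⟩ ⟨e', -, h⟩
    exact Fin.succ_ne_zero _ (congrArg (fun e => e.1.1) h).symm
  have hcard : B.ncard = o.elim 0 fun b => countNotMemBelow (blockMinima p) b := by
    cases o with
    | none => simp [hB]
    | some b =>
      have : B = Prod.mk b '' {e : Fin n × Fin n | IsArc p e.1 e.2 ∧ (e.2 : ℕ) < b} := by
        ext ⟨b', x, y⟩
        simp only [hB, Set.mem_ofPred_eq, Set.mem_image, Prod.mk.injEq, Option.some_inj,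
          exists_eq_right_right, Fin.lt_def]
        constructor
        · rintro ⟨rfl, h⟩
          exact ⟨h, rfl⟩
        · rintro ⟨h, rfl⟩
          exact ⟨rfl, h⟩
      rw [this, Set.ncard_image_of_injective _ (Prod.mk_right_injective b), Option.elim_some,
        ← vStat_eq, vStat]
  rw [ne', hunion, Set.ncard_union_eq hdisj (Set.toFinite _) (Set.toFinite _),
    Set.ncard_image_of_injective _ hfinj, Set.ncard_image_of_injective _ hginj, hcard]
  rfl

lemma isChild_iff {c : SetPartition (n + 1)} {p : SetPartition n} :
    IsChild c p ↔ ∃ o ∈ insertNone (blockMinima p), addZero p o = c := by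
  constructor
  · intro h
    by_cases h0 : ∃ j : Fin n, InSameBlock c 0 j.succ
    · obtain ⟨j, hj⟩ := h0
      obtain ⟨B, hB, hjB⟩ := p.exists_mem (mem_univ j)
      obtain ⟨b, hbB, hb, -⟩ := exists_minOfBlock_eq hB
      have hjb : InSameBlock c j.succ b.succ := (h j b).1 ⟨B, hB, hjB, hbB⟩
      have hcb : ∀ k : Fin n, InSameBlock (addZero p (some b)) 0 k.succ ↔
          InSameBlock c 0 k.succ := by
        intro k
        simp only [inSameBlock_addZero_zero, Option.mem_some_iff, exists_eq_left', h b k]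
        exact ⟨fun hk => (hj.trans hjb).trans hk, fun hk => (hj.trans hjb).symm.trans hk⟩
      refine ⟨some b, by simpa using hb, inSameBlock_ext ?_⟩
      simp only [Fin.forall_fin_succ, hcb, inSameBlock_addZero_succ, inSameBlock_refl, h _ _,
        implies_true, true_and, and_true]
      exact fun k => ⟨fun hk => ((hcb k).1 hk.symm).symm, fun hk => ((hcb k).2 hk.symm).symm⟩
    · have hcb : ∀ k : Fin n, InSameBlock (addZero p none) 0 k.succ ↔
          InSameBlock c 0 k.succ := by
        intro k
        rw [inSameBlock_addZero_zero]
        simpa using fun hk => h0 ⟨k, hk⟩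
      refine ⟨none, by simp, inSameBlock_ext ?_⟩
      simp only [Fin.forall_fin_succ, hcb, inSameBlock_addZero_succ, inSameBlock_refl, h _ _,
        implies_true, true_and, and_true]
      exact fun k => ⟨fun hk => ((hcb k).1 hk.symm).symm, fun hk => ((hcb k).2 hk.symm).symm⟩
  · rintro ⟨o, -, rfl⟩ i j
    exact (inSameBlock_addZero_succ p o i j).symm

lemma IsChild.eq {c : SetPartition (n + 1)} {p q : SetPartition n} (hp : IsChild c p)
    (hq : IsChild c q) : p = q :=
  inSameBlock_ext fun i j => (hp i j).trans (hq i j).symm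

lemma injOn_addZero (p : SetPartition n) :
    Set.InjOn (addZero p) (insertNone (blockMinima p)) := by
  intro o ho o' ho' h
  ext b
  constructor
  · intro hb
    have := mem_insertNone.1 ho b hb
    exact (inSameBlock_addZero_zero_iff ho' this).1
      (h ▸ (inSameBlock_addZero_zero_iff ho this).2 hb)
  · intro hb
    have := mem_insertNone.1 ho' b hb
    exact (inSameBlock_addZero_zero_iff ho this).1
      (h.symm ▸ (inSameBlock_addZero_zero_iff ho' this).2 hb)

end Children

section Distribution

variable {n : ℕ}

open Classical in
/-- The children of `p`. -/
noncomputable def children (p : SetPartition n) : Finset (SetPartition (n + 1)) :=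
  (insertNone (blockMinima p)).image (addZero p)

lemma mem_children {p : SetPartition n} {c : SetPartition (n + 1)} :
    c ∈ children p ↔ IsChild c p := by
  simp [children, isChild_iff]

/-- The level `level p l` as a finset. -/
noncomputable def levelFinset (p : SetPartition n) (l : ℕ) : Finset (SetPartition (n + l)) :=
  (Set.toFinite (level p l)).toFinset

lemma mem_levelFinset {p : SetPartition n} {l : ℕ} {t : SetPartition (n + l)} :
    t ∈ levelFinset p l ↔ t ∈ level p l := by
  simp [levelFinset]

/-- The number of nestings of `p` together with its block minima. -/
noncomputable def neData (p : SetPartition n) : ℕ × Finset (Fin n) :=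
  (ne' p, blockMinima p)

/-- The joint distribution of `ne'` and `blockMinima` on `level p l`. -/
noncomputable def neDist (p : SetPartition n) (l : ℕ) : Multiset (ℕ × Finset (Fin (n + l))) :=
  (levelFinset p l).val.map neData

/-- The data of the children of a partition with data `d`. -/
noncomputable def childrenData (d : ℕ × Finset (Fin n)) : Multiset (ℕ × Finset (Fin (n + 1))) :=
  (insertNone d.2).val.map (addZeroData d)

lemma map_neData_children (p : SetPartition n) :
    (children p).val.map neData = childrenData (neData p) := by
  classical
  rw [children, image_val_of_injOn (injOn_addZero p), Multiset.map_map, childrenData]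
  exact Multiset.map_congr rfl fun o ho =>
    Prod.ext (ne'_addZero ho) (blockMinima_addZero ho _)

lemma neDist_zero (p : SetPartition n) : neDist p 0 = {neData p} := by
  have : levelFinset p 0 = {p} := by
    ext t
    rw [mem_levelFinset, mem_singleton]
    rfl
  rw [neDist, this]
  rfl

lemma neDist_succ (p : SetPartition n) (l : ℕ) :
    neDist p (l + 1) = (neDist p l).bind childrenData := by
  have hdisj : (levelFinset p l : Set (SetPartition (n + l))).PairwiseDisjoint children := by
    intro q _ q' _ hne
    refine disjoint_left.2 fun c hc hc' => hne ?_
    exact (mem_children.1 hc).eq (mem_children.1 hc')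
  have : levelFinset p (l + 1) = (levelFinset p l).disjiUnion children hdisj := by
    ext t
    rw [mem_levelFinset, mem_disjiUnion]
    simp only [mem_children, mem_levelFinset]
    rfl
  rw [neDist, this, disjiUnion_val, Multiset.map_bind, neDist, Multiset.bind_map]
  exact Multiset.bind_congr fun q _ => map_neData_children q

lemma neDist_congr {p q : SetPartition n} (h : neData p = neData q) (l : ℕ) :
    neDist p l = neDist q l := by
  induction l with
  | zero => rw [neDist_zero, neDist_zero, h]
  | succ l ih => rw [neDist_succ, neDist_succ, ih]

lemma ncard_level_eq (p : SetPartition n) (l m c : ℕ) :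
    {t ∈ level p l | t.parts.card = m ∧ ne' t = c}.ncard =
      (neDist p l).countP fun d => #d.2 = m ∧ d.1 = c := by
  classical
  rw [neDist, Multiset.countP_map, ← filter_val, card_val, ← Set.ncard_coe_finset]
  congr 1
  ext t
  simp [mem_levelFinset, neData, card_blockMinima]

lemma card_addZeroData_none (d : ℕ × Finset (Fin n)) : #(addZeroData d none).2 = #d.2 + 1 := by
  simp [addZeroData]

lemma card_addZeroData_some (d : ℕ × Finset (Fin n)) {b : Fin n} (hb : b ∈ d.2) :
    #(addZeroData d (some b)).2 = #d.2 := by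
  classical
  have : (d.2.filter fun b' => some b ≠ some b') = d.2.erase b := by
    ext x
    simp [eq_comm, and_comm]
  rw [addZeroData, this, card_insert_of_notMem (by simp), card_map, card_erase_add_one hb]

lemma countP_neDist_one (p : SetPartition n) (c : ℕ) :
    ((neDist p 1).countP fun d => #d.2 = #(blockMinima p) ∧ d.1 = c) =
      (((countSeq (blockMinima p) : Multiset ℕ)).map (ne' p + ·)).count c := by
  classical
  have hone : neDist p 1 = childrenData (neData p) := by
    rw [neDist_succ, neDist_zero, Multiset.singleton_bind]
  have hnone : (insertNone (neData p).2).val = none ::ₘ (blockMinima p).val.map some := rfl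
  rw [hone, childrenData, hnone, Multiset.map_cons, Multiset.countP_cons_of_neg, Multiset.map_map,
    Multiset.countP_map, coe_countSeq, Multiset.map_map, Multiset.count, Multiset.countP_map]
  · congr 1
    refine Multiset.filter_congr fun b hb => ?_
    have := card_addZeroData_some (neData p) hb
    simp only [Function.comp_apply, this]
    simp [neData, addZeroData, eq_comm]
  · rw [card_addZeroData_none]
    simp [neData]

end Distribution

/-- For partitions `p, q` of `[n]` (`n ≥ 1`): `p ∼_ne q` if and only if
`ne p = ne q` and `neseq p = neseq q` as sequences. -/
theorem statement12 {n : ℕ} (hn : 1 ≤ n) (p q : SetPartition n) :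
    SimNe p q ↔ ne' p = ne' q ∧ neseq p = neseq q := by
  rw [neseq_eq, neseq_eq, countSeq_injective.eq_iff]
  simp only [SimNe, ncard_level_eq]
  constructor
  · intro h
    obtain ⟨hcard, hne⟩ : #(blockMinima q) = #(blockMinima p) ∧ ne' q = ne' p := by
      by_contra hcon
      have h0 := h 0 #(blockMinima p) (ne' p)
      rw [neDist_zero, neDist_zero, ← Multiset.cons_zero (neData p),
        ← Multiset.cons_zero (neData q), Multiset.countP_cons_of_pos _ (by simp [neData]),
        Multiset.countP_cons_of_neg _ (by exact hcon)] at h0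
      simp at h0
    refine ⟨hne.symm, countSeq_injective ?_⟩
    have h1 : ((countSeq (blockMinima p) : Multiset ℕ)).map (ne' p + ·) =
        ((countSeq (blockMinima q) : Multiset ℕ)).map (ne' p + ·) := by
      ext c
      rw [← countP_neDist_one, h 1, ← hcard, countP_neDist_one, hne]
    have h2 := Multiset.coe_eq_coe.1 (Multiset.map_injective (add_right_injective (ne' p)) h1)
    exact h2.eq_of_pairwise' (pairwise_countSeq _) (pairwise_countSeq _)
  · rintro ⟨hne, hmin⟩ l m c
    rw [neDist_congr (Prod.ext hne hmin)]
end

section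
/- Let n ≥ k ≥ 1 and let λ be a partition of [n] with exactly k blocks. Let l be the maximum element of the multiset crset(λ) and for 0 ≤ i ≤ l let d_i be the multiplicity of i in crset(λ). Then d_i ≥ 1 for every 0 ≤ i ≤ l, d_0 + d_1 + ⋯ + d_l = k (so (d_0,…,d_l) is a composition of k), l ≤ n − k, and 0 ≤ cr(λ) ≤ (n−k−1)l − l(l−1)/2. -/
open Finset

theorem IsArc.left_unique {n : ℕ} {p : SetPartition n} {x x' y : Fin n}
    (h : IsArc p x y) (h' : IsArc p x' y) : x = x' := by
  obtain ⟨hlt, B, hB, hx, hy, hbetween⟩ := h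
  obtain ⟨hlt', B', hB', hx', hy', hbetween'⟩ := h'
  obtain rfl := p.eq_of_mem_parts hB hB' hy hy'
  have h₁ := hbetween x' hx'
  have h₂ := hbetween' x hx
  grind

theorem IsArc.right_unique {n : ℕ} {p : SetPartition n} {x y y' : Fin n}
    (h : IsArc p x y) (h' : IsArc p x y') : y = y' := by
  obtain ⟨hlt, B, hB, hx, hy, hbetween⟩ := h
  obtain ⟨hlt', B', hB', hx', hy', hbetween'⟩ := h'
  obtain rfl := p.eq_of_mem_parts hB hB' hx hx'
  have h₁ := hbetween y' hy'
  have h₂ := hbetween' y hy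
  grind

theorem minOfBlock_eq_min' {n : ℕ} {B : Finset (Fin n)} (hB : B.Nonempty) :
    minOfBlock B = (B.min' hB : ℕ) := by
  apply le_antisymm
  · exact Nat.sInf_le ⟨_, B.min'_mem hB, rfl⟩
  · refine le_csInf (Set.Nonempty.image _ hB) ?_
    rintro _ ⟨x, hx, rfl⟩
    exact B.min'_le x hx

theorem exists_min_or_exists_arc {n : ℕ} (p : SetPartition n) (v : Fin n) :
    (∃ B ∈ p.parts, minOfBlock B = v) ∨ ∃ x, IsArc p x v := by
  obtain ⟨B, hB, hv⟩ := p.exists_mem (mem_univ v)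
  by_cases h : (B.filter (· < v)).Nonempty
  · right
    have hmem := mem_filter.1 (max'_mem _ h)
    refine ⟨_, hmem.2, B, hB, hmem.1, hv, fun x hx hbetween => ?_⟩
    exact absurd (le_max' _ x (mem_filter.2 ⟨hx, hbetween.2⟩)) (not_le.2 hbetween.1)
  · left
    refine ⟨B, hB, ?_⟩
    rw [minOfBlock_eq_min' ⟨v, hv⟩]
    congr 1
    apply le_antisymm (min'_le _ _ hv)
    by_contra hlt
    exact h ⟨_, mem_filter.2 ⟨min'_mem B ⟨v, hv⟩, not_le.1 hlt⟩⟩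

theorem not_isArc_min' {n : ℕ} {p : SetPartition n} {B : Finset (Fin n)} (hB : B ∈ p.parts)
    (hne : B.Nonempty) (x : Fin n) : ¬ IsArc p x (B.min' hne) := by
  rintro ⟨hlt, B', hB', hx, hy, -⟩
  obtain rfl := p.eq_of_mem_parts hB hB' (min'_mem B hne) hy
  exact absurd (min'_le _ x hx) (not_le.2 hlt)

open Classical in
/-- The finite set of arcs of a partition. -/
noncomputable def arcs {n : ℕ} (p : SetPartition n) : Finset (Fin n × Fin n) :=
  univ.filter fun e => IsArc p e.1 e.2

theorem mem_arcs {n : ℕ} {p : SetPartition n} {e : Fin n × Fin n} :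
    e ∈ arcs p ↔ IsArc p e.1 e.2 := by
  simp [arcs]

theorem injOn_snd_arcs {n : ℕ} (p : SetPartition n) :
    Set.InjOn Prod.snd (arcs p : Set (Fin n × Fin n)) := by
  rintro ⟨x, y⟩ h ⟨x', y'⟩ h' hy
  obtain rfl : y = y' := hy
  have hx : IsArc p x y := mem_arcs.1 (mem_coe.1 h)
  have hx' : IsArc p x' y := mem_arcs.1 (mem_coe.1 h')
  rw [hx.left_unique hx']

theorem uStat_eq_card {n : ℕ} (p : SetPartition n) (b : ℕ) :
    uStat p b = ((arcs p).filter fun e => (e.1 : ℕ) < b ∧ b < (e.2 : ℕ)).card := by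
  rw [uStat, ← Set.ncard_coe_finset]
  congr 1
  ext e
  simp [mem_arcs]

theorem card_arcs_add_card_parts_le {n : ℕ} (p : SetPartition n) :
    (arcs p).card + p.parts.card ≤ n := by
  classical
  let m : {B // B ∈ p.parts} → Fin n := fun B => B.1.min' (p.nonempty_of_mem_parts B.2)
  have hm : Function.Injective m := fun B C h => Subtype.ext <|
    p.eq_of_mem_parts B.2 C.2 (min'_mem _ (p.nonempty_of_mem_parts B.2))
      (by
        change m B ∈ C.1
        rw [h]
        exact min'_mem _ _)
  have hdisj : Disjoint ((arcs p).image Prod.snd) (univ.image m) := by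
    rw [disjoint_left]
    intro v hv hv'
    obtain ⟨e, he, rfl⟩ := mem_image.1 hv
    obtain ⟨B, -, hB⟩ := mem_image.1 hv'
    refine not_isArc_min' B.2 (p.nonempty_of_mem_parts B.2) e.1 ?_
    change IsArc p e.1 (m B)
    rw [hB]
    exact mem_arcs.1 he
  have hcard := card_le_univ ((arcs p).image Prod.snd ∪ univ.image m)
  rw [card_union_of_disjoint hdisj, card_image_of_injOn (injOn_snd_arcs p),
    card_image_of_injective _ hm] at hcard
  simpa using hcard

theorem card_open_arcs_le {n : ℕ} (p : SetPartition n) (v : ℕ) :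
    ((arcs p).filter fun e => (e.1 : ℕ) < v + 1 ∧ v + 1 ≤ (e.2 : ℕ)).card ≤ uStat p v + 1 := by
  classical
  have hstart : ((arcs p).filter fun e => (e.1 : ℕ) = v).card ≤ 1 := by
    rw [card_le_one]
    rintro ⟨x, y⟩ h ⟨x', y'⟩ h'
    simp only [mem_filter, mem_arcs] at h h'
    obtain rfl : x = x' := Fin.ext (h.2.trans h'.2.symm)
    rw [h.1.right_unique h'.1]
  rw [uStat_eq_card]
  refine le_trans (card_le_card (t := _ ∪ (arcs p).filter fun e => (e.1 : ℕ) = v) ?_)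
    ((card_union_le _ _).trans (Nat.add_le_add_left hstart _))
  intro e he
  simp only [mem_union, mem_filter] at he ⊢
  obtain ⟨h, h₁, h₂⟩ := he
  rcases Nat.lt_succ_iff_lt_or_eq.1 h₁ with h₃ | h₃
  · exact Or.inl ⟨h, h₃, h₂⟩
  · exact Or.inr ⟨h, h₃⟩

theorem uStat_succ_le {n : ℕ} (p : SetPartition n) (v : ℕ) :
    uStat p (v + 1) ≤ uStat p v + 1 := by
  refine le_trans ?_ (card_open_arcs_le p v)
  rw [uStat_eq_card]
  exact card_le_card (monotone_filter_right _ fun e _ h => ⟨h.1, h.2.le⟩)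

theorem uStat_succ_le_of_isArc {n : ℕ} {p : SetPartition n} {v : ℕ} {x y : Fin n}
    (h : IsArc p x y) (hy : (y : ℕ) = v + 1) : uStat p (v + 1) ≤ uStat p v := by
  refine Nat.le_of_lt_succ (lt_of_lt_of_le ?_ (card_open_arcs_le p v))
  rw [uStat_eq_card]
  refine card_lt_card ((ssubset_iff_of_subset ?_).2 ⟨(x, y), ?_, ?_⟩)
  · exact monotone_filter_right _ fun e _ h => ⟨h.1, h.2.le⟩
  · have hlt : (x : ℕ) < y := h.1
    simp only [mem_filter, mem_arcs]
    exact ⟨h, by omega, by omega⟩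
  · simp only [mem_filter]
    omega

theorem exists_uStat_minOfBlock_eq {n : ℕ} (p : SetPartition n) (v : ℕ) (hv : v < n) :
    ∀ i ≤ uStat p v, ∃ B ∈ p.parts, uStat p (minOfBlock B) = i := by
  induction v with
  | zero =>
    intro i hi
    have h₀ : uStat p 0 = 0 := by simp [uStat_eq_card]
    obtain ⟨B, hB, hB'⟩ | ⟨x, hx, -⟩ := exists_min_or_exists_arc p ⟨0, hv⟩
    · exact ⟨B, hB, by rw [hB']; dsimp only; omega⟩
    · exact absurd hx (Nat.not_lt_zero _)
  | succ v ih =>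
    intro i hi
    obtain ⟨B, hB, hB'⟩ | ⟨x, hx⟩ := exists_min_or_exists_arc p ⟨v + 1, hv⟩
    · rcases hi.eq_or_lt with rfl | hlt
      · exact ⟨B, hB, by rw [hB']⟩
      · exact ih (by omega) i (by have := uStat_succ_le p v; omega)
    · exact ih (by omega) i (hi.trans (uStat_succ_le_of_isArc hx rfl))

theorem uStat_le_sup_crset {n : ℕ} (p : SetPartition n) (v : Fin n) :
    uStat p v ≤ (crset p).sup := by
  obtain ⟨B, hB, hB'⟩ := exists_uStat_minOfBlock_eq p v v.2 _ le_rfl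
  exact Multiset.le_sup (Multiset.mem_map.2 ⟨B, hB, hB'⟩)

theorem mem_crset_of_le_sup {n : ℕ} {p : SetPartition n} (hp : p.parts.Nonempty) {i : ℕ}
    (hi : i ≤ (crset p).sup) : i ∈ crset p := by
  obtain ⟨B, hB, hmax⟩ := exists_max_image p.parts (fun B => uStat p (minOfBlock B)) hp
  have hsup : (crset p).sup ≤ uStat p (minOfBlock B) := by
    refine Multiset.sup_le.2 fun b hb => ?_
    obtain ⟨C, hC, rfl⟩ := Multiset.mem_map.1 hb
    exact hmax C hC
  obtain ⟨C, hC, hC'⟩ := exists_uStat_minOfBlock_eq p (minOfBlock B)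
    (by
      rw [minOfBlock_eq_min' (p.nonempty_of_mem_parts hB)]
      exact Fin.is_lt _)
    i (hi.trans hsup)
  exact Multiset.mem_map.2 ⟨C, hC, hC'⟩

theorem sum_count_range_sup (s : Multiset ℕ) :
    ∑ i ∈ range (s.sup + 1), s.count i = s.card :=
  Multiset.sum_count_eq_card fun _ ha => mem_range.2 (Nat.lt_succ_of_le (Multiset.le_sup ha))

theorem sum_min_card_filter_lt {α : Type*} [LinearOrder α] (l : ℕ) (T : Finset α) :
    ∑ t ∈ T, min l (T.filter (t < ·)).card = ∑ i ∈ range T.card, min l i := by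
  induction T using Finset.induction_on_min with
  | empty => simp
  | insert a T ha ih =>
    have haT : a ∉ T := fun h => lt_irrefl a (ha a h)
    rw [sum_insert haT, card_insert_of_notMem haT, sum_range_succ, ← ih, add_comm]
    congr 1
    · refine sum_congr rfl fun t ht => ?_
      rw [filter_insert, if_neg (ha t ht).not_gt]
    · rw [filter_insert, if_neg (lt_irrefl a), filter_true_of_mem ha]

theorem two_mul_sum_range_min_add {l m : ℕ} (h : l ≤ m) :
    2 * ∑ i ∈ range m, min l i + l * (l - 1) = 2 * ((m - 1) * l) := by
  induction m, h using Nat.le_induction with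
  | base =>
    have : ∑ i ∈ range l, min l i = ∑ i ∈ range l, i :=
      sum_congr rfl fun i hi => min_eq_right (mem_range.1 hi).le
    rw [this, mul_comm 2, sum_range_id_mul_two]
    ring
  | succ m h ih =>
    rw [sum_range_succ, min_eq_left h]
    rcases m with _ | m
    · obtain rfl : l = 0 := by omega
      simp
    · simp only [Nat.add_sub_cancel] at ih ⊢
      linarith

theorem sum_range_min_le {l m : ℕ} (h : l ≤ m) :
    ∑ i ∈ range m, min l i ≤ (m - 1) * l - l * (l - 1) / 2 := by
  have := two_mul_sum_range_min_add h
  omega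

theorem cr_le_sum_range_min {n : ℕ} (p : SetPartition n) :
    cr p ≤ ∑ i ∈ range (arcs p).card, min (crset p).sup i := by
  classical
  have hcr : cr p = ∑ a ∈ arcs p, ((arcs p).filter fun b => Crossing a b).card := by
    have hset : {e : (Fin n × Fin n) × (Fin n × Fin n) |
        IsArc p e.1.1 e.1.2 ∧ IsArc p e.2.1 e.2.2 ∧ Crossing e.1 e.2} =
        ((arcs p ×ˢ arcs p).filter fun e => Crossing e.1 e.2 : Finset _) := by
      ext e
      simp [mem_arcs, and_assoc]
    rw [cr, hset, Set.ncard_coe_finset, card_filter, sum_product]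
    simp only [card_filter]
  rw [hcr, ← card_image_of_injOn (injOn_snd_arcs p), ← sum_min_card_filter_lt,
    sum_image (injOn_snd_arcs p)]
  refine sum_le_sum fun a _ => le_min ?_ ?_
  · refine le_trans ?_ (uStat_le_sup_crset p a.2)
    rw [uStat_eq_card]
    exact card_le_card (monotone_filter_right _ fun b _ h => ⟨h.2.1, h.2.2⟩)
  · refine card_le_card_of_injOn Prod.snd ?_
      ((injOn_snd_arcs p).mono (coe_subset.2 (filter_subset _ _)))
    intro b hb
    have hb' := mem_filter.1 hb
    exact mem_coe.2 (mem_filter.2 ⟨mem_image_of_mem _ hb'.1, hb'.2.2.2⟩)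

/-- Lemma 4.4(a). Let `p` be a partition of `[n]` with `k` blocks
(`n ≥ k ≥ 1`), let `l` be the maximum of the multiset `crset p` and `d_i` the
multiplicity of `i` in `crset p`. Then every `d_i` with `i ≤ l` is positive, the `d_i`
form a composition of `k`, `l ≤ n - k`, and `cr p ≤ (n-k-1)·l - l(l-1)/2`. -/
theorem statement13 {n k : ℕ} (hk : 1 ≤ k) (hkn : k ≤ n)
    (p : SetPartition n) (hpk : p.parts.card = k) :
    (∀ i ≤ (crset p).sup, 1 ≤ (crset p).count i) ∧
    (∑ i ∈ Finset.range ((crset p).sup + 1), (crset p).count i) = k ∧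
    (crset p).sup ≤ n - k ∧
    cr p ≤ (n - k - 1) * (crset p).sup - (crset p).sup * ((crset p).sup - 1) / 2 := by
  have hcard := card_arcs_add_card_parts_le p
  have hsup : (crset p).sup ≤ (arcs p).card := by
    refine Multiset.sup_le.2 fun b hb => ?_
    obtain ⟨B, -, rfl⟩ := Multiset.mem_map.1 hb
    rw [uStat_eq_card]
    exact card_filter_le _ _
  have hle : (arcs p).card ≤ n - k := by omega
  refine ⟨fun i hi => ?_, ?_, hsup.trans hle, ?_⟩
  · exact Multiset.one_le_count_iff_mem.2
      (mem_crset_of_le_sup (card_pos.1 (by omega)) hi)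
  · rw [sum_count_range_sup, ← hpk]
    exact Multiset.card_map _ _
  · exact (cr_le_sum_range_min p).trans
      ((sum_le_sum_of_subset (range_mono hle)).trans (sum_range_min_le (hsup.trans hle)))
end

section
/- Let n ≥ k ≥ 1. Given a composition (d_0,…,d_l) of k into l+1 parts with l+1 ≤ n−k+1, and an integer c with 0 ≤ c ≤ (n−k−1)l − l(l−1)/2, there exists a partition λ of [n] with exactly k blocks such that crset(λ) is the multiset in which each i ∈ {0,…,l} occurs exactly d_i times, and cr(λ) = c. -/
open Finset

theorem exists_mem_card_filter_lt (r : ℕ) (A : Finset ℕ) (h : r < A.card) :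
    ∃ a ∈ A, (A.filter fun x => a < x).card = r := by
  induction r generalizing A with
  | zero =>
    have hA : A.Nonempty := card_pos.mp h
    refine ⟨A.max' hA, A.max'_mem hA, ?_⟩
    rw [card_eq_zero, filter_eq_empty_iff]
    intro x hx
    exact not_lt.mpr (A.le_max' x hx)
  | succ r ih =>
    have hA : A.Nonempty := card_pos.mp (by omega)
    have hM := A.max'_mem hA
    obtain ⟨a, ha, hr⟩ := ih (A.erase (A.max' hA)) (by rw [card_erase_of_mem hM]; omega)
    have ha' := mem_erase.mp ha
    refine ⟨a, ha'.2, ?_⟩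
    have hlt : a < A.max' hA := lt_of_le_of_ne (A.le_max' a ha'.2) ha'.1
    have hmem : A.max' hA ∈ A.filter fun x => a < x := mem_filter.mpr ⟨hM, hlt⟩
    rw [filter_erase] at hr
    rw [← card_erase_add_one hmem, hr]

/-- The number of crossings between the arcs `(g j, j)`, for `N ≤ j < e`. -/
def crossSum (g : ℕ → ℕ) (N e : ℕ) : ℕ :=
  ∑ i ∈ Ico N e, ((Ico (i + 1) e).filter fun j => g i < g j ∧ g j < i).card

/-- The arcs `(g j, j)`, for `N ≤ j < e`, form a matching of left to right endpoints, and the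
left endpoints below `N` are the elements of `A`. -/
structure IsArcSystem (A : Finset ℕ) (N e : ℕ) (g : ℕ → ℕ) : Prop where
  injOn : ∀ i j, N ≤ i → i < e → N ≤ j → j < e → g i = g j → i = j
  lt : ∀ j, N ≤ j → j < e → g j < j
  mem : ∀ j, N ≤ j → j < e → g j < N → g j ∈ A
  surj : ∀ a ∈ A, ∃ j, N ≤ j ∧ j < e ∧ g j = a

theorem crossSum_congr {g g' : ℕ → ℕ} {N e : ℕ} (h : ∀ j, N ≤ j → g j = g' j) :
    crossSum g N e = crossSum g' N e := by
  refine sum_congr rfl fun i hi => congrArg card (filter_congr fun j hj => ?_)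
  rw [mem_Ico] at hi hj
  rw [h i hi.1, h j (by omega)]

/-- Prepending the arc `(a, N)` to an arc system. -/
theorem IsArcSystem.extend {A B : Finset ℕ} {N e a : ℕ} {g : ℕ → ℕ}
    (hg : IsArcSystem B (N + 1) e g) (hA : ∀ x ∈ A, x < N) (ha : a ∈ A) (he : N < e)
    (hB : ∀ x < N, x ∈ B ↔ x ∈ A ∧ x ≠ a) :
    IsArcSystem A N e (Function.update g N a) ∧
      crossSum (Function.update g N a) N e =
        (A.filter fun x => a < x).card + crossSum g (N + 1) e := by
  have hupd : ∀ j, N + 1 ≤ j → Function.update g N a j = g j := fun j hj =>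
    Function.update_of_ne (by omega) _ _
  have haN := hA a ha
  have hne : ∀ j, N + 1 ≤ j → j < e → g j ≠ a := fun j h1 h2 h3 =>
    ((hB a haN).mp (h3 ▸ hg.mem j h1 h2 (by omega))).2 rfl
  refine ⟨⟨?_, ?_, ?_, ?_⟩, ?_⟩
  · intro i j hi hie hj hje h
    rcases Nat.eq_or_lt_of_le hi with rfl | hi <;> rcases Nat.eq_or_lt_of_le hj with rfl | hj
    · rfl
    · rw [Function.update_self, hupd j hj] at h
      exact absurd h.symm (hne j hj hje)
    · rw [Function.update_self, hupd i hi] at h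
      exact absurd h (hne i hi hie)
    · rw [hupd i hi, hupd j hj] at h
      exact hg.injOn i j hi hie hj hje h
  · intro j hj hje
    rcases Nat.eq_or_lt_of_le hj with rfl | hj
    · simpa using haN
    · rw [hupd j hj]; exact hg.lt j hj hje
  · intro j hj hje h
    rcases Nat.eq_or_lt_of_le hj with rfl | hj
    · simpa using ha
    · rw [hupd j hj] at h ⊢
      exact ((hB _ h).mp (hg.mem j hj hje (by omega))).1
  · intro x hx
    by_cases hxa : x = a
    · exact ⟨N, le_rfl, he, by simp [hxa]⟩
    · obtain ⟨j, h1, h2, h3⟩ := hg.surj x ((hB x (hA x hx)).mpr ⟨hx, hxa⟩)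
      exact ⟨j, by omega, h2, by rw [hupd j h1, h3]⟩
  · rw [← crossSum_congr hupd, crossSum, crossSum, ← sum_Ioo_add_eq_sum_Ico he, add_comm]
    congr 1
    rw [Function.update_self]
    refine card_bij (fun j _ => Function.update g N a j) ?_ ?_ ?_
    · intro j hj
      rw [mem_filter, mem_Ico] at hj
      obtain ⟨⟨h1, h2⟩, h3, h4⟩ := hj
      rw [mem_filter]
      refine ⟨?_, h3⟩
      rw [hupd j h1] at h4 ⊢
      exact ((hB _ h4).mp (hg.mem j h1 h2 (by omega))).1
    · intro i hi j hj h
      rw [mem_filter, mem_Ico] at hi hj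
      rw [hupd i hi.1.1, hupd j hj.1.1] at h
      exact hg.injOn i j hi.1.1 hi.1.2 hj.1.1 hj.1.2 h
    · intro x hx
      rw [mem_filter] at hx
      obtain ⟨j, h1, h2, h3⟩ := hg.surj x ((hB x (hA x hx.1)).mpr ⟨hx.1, by omega⟩)
      refine ⟨j, ?_, by rw [hupd j h1, h3]⟩
      rw [mem_filter, mem_Ico, hupd j h1, h3]
      exact ⟨⟨h1, h2⟩, hx.2, hA x hx.1⟩

theorem exists_isArcSystem_crossSum (m N s c : ℕ) (A : Finset ℕ) (hA : ∀ x ∈ A, x < N)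
    (hm : m = A.card + s) (h0 : A.card = 0 → s = 0)
    (hc : c ≤ s * (A.card - 1) + ∑ i ∈ range A.card, i) :
    ∃ g, IsArcSystem A N (N + m) g ∧ crossSum g N (N + m) = c := by
  induction m generalizing N s c A with
  | zero =>
    have hA0 : A = ∅ := card_eq_zero.mp (by omega)
    subst hA0
    obtain rfl : s = 0 := by simpa using h0
    obtain rfl : c = 0 := by simpa using hc
    exact ⟨id, ⟨by intros; omega, by intros; omega, by intros; omega, by simp⟩,
      by simp [crossSum]⟩
  | succ m ih =>
    obtain ⟨L, hL⟩ : ∃ L, A.card = L + 1 := ⟨A.card - 1, by omega⟩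
    obtain ⟨a, ha, har⟩ := exists_mem_card_filter_lt (min c L) A (by omega)
    have haN := hA a ha
    have hcard : (A.erase a).card = L := by rw [card_erase_of_mem ha]; omega
    have hNA : N ∉ A.erase a := fun h => lt_irrefl N (hA N (mem_erase.mp h).2)
    have key : ∃ B : Finset ℕ, (∀ x ∈ B, x < N + 1) ∧ (∀ x < N, x ∈ B ↔ x ∈ A ∧ x ≠ a) ∧
        ∃ g, IsArcSystem B (N + 1) (N + 1 + m) g ∧
          crossSum g (N + 1) (N + 1 + m) = c - min c L := by
      rw [hL] at hc hm
      cases s with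
      | zero =>
        refine ⟨A.erase a, fun x hx => ?_, fun x _ => ?_, ?_⟩
        · have := hA x (mem_erase.mp hx).2
          omega
        · rw [mem_erase, and_comm]
        · refine ih (N + 1) 0 _ _ (fun x hx => ?_) (by omega) (by simp) ?_
          · have := hA x (mem_erase.mp hx).2
            omega
          · rw [hcard]
            rw [sum_range_succ] at hc
            omega
      | succ s =>
        have hB : ∀ x ∈ insert N (A.erase a), x < N + 1 := by
          intro x hx
          rcases mem_insert.mp hx with rfl | hx
          · omega
          · have := hA x (mem_erase.mp hx).2
            omega
        refine ⟨insert N (A.erase a), hB, fun x hx => ?_, ?_⟩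
        · rw [mem_insert, mem_erase]
          constructor
          · rintro (rfl | h)
            · omega
            · exact h.symm
          · exact fun h => Or.inr h.symm
        · have hcard' : (insert N (A.erase a)).card = L + 1 := by
            rw [card_insert_of_notMem hNA, hcard]
          refine ih (N + 1) s _ _ hB (by omega) (by omega) ?_
          rw [hcard']
          simp only [Nat.add_sub_cancel, add_mul, one_mul] at hc ⊢
          omega
    obtain ⟨B, -, hB, g, hg, hgc⟩ := key
    rw [show N + 1 + m = N + (m + 1) by ring] at hg hgc
    obtain ⟨h1, h2⟩ := hg.extend hA ha (by omega) hB
    exact ⟨_, h1, by rw [h2, har, hgc]; omega⟩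

/-- The element below `k` reached from `j` by following the arcs `(g j, j)` backwards. -/
def root (g : ℕ → ℕ) (k j : ℕ) : ℕ :=
  if _h : k ≤ j ∧ g j < j then root g k (g j) else j
termination_by j

theorem root_of_lt {g : ℕ → ℕ} {k j : ℕ} (h : j < k) : root g k j = j := by
  rw [root, dif_neg (by omega)]

theorem root_of_le {g : ℕ → ℕ} {k j : ℕ} (h : k ≤ j) (hg : g j < j) :
    root g k j = root g k (g j) := by
  rw [root, dif_pos ⟨h, hg⟩]

theorem root_le (g : ℕ → ℕ) (k j : ℕ) : root g k j ≤ j := by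
  induction j using Nat.strong_induction_on with
  | _ j ih =>
    rw [root]
    split_ifs with h
    · exact (ih _ h.2).trans h.2.le
    · exact le_rfl

theorem IsArcSystem.root_lt {A : Finset ℕ} {k n : ℕ} {g : ℕ → ℕ} (hg : IsArcSystem A k n g)
    {j : ℕ} (hj : j < n) : root g k j < k := by
  induction j using Nat.strong_induction_on with
  | _ j ih =>
    by_cases h : k ≤ j
    · have := hg.lt j h hj
      rw [root_of_le h this]
      exact ih _ this (by omega)
    · rw [root_of_lt (by omega)]
      omega

theorem IsArcSystem.le_of_root_eq {A : Finset ℕ} {k n : ℕ} {g : ℕ → ℕ}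
    (hg : IsArcSystem A k n g) (s : ℕ) {i j : ℕ} (hs : i + j ≤ s) (hij : i < j) (hj : j < n)
    (h : root g k i = root g k j) : k ≤ j ∧ i ≤ g j := by
  induction s generalizing i j with
  | zero => omega
  | succ s ih =>
    have hkj : k ≤ j := by
      by_contra! hjk
      rw [root_of_lt hjk, root_of_lt (by omega)] at h
      omega
    refine ⟨hkj, ?_⟩
    by_contra! hlt
    have hgj := hg.lt j hkj hj
    have h' := root_of_le hkj hgj
    obtain ⟨hki, hle⟩ := ih (i := g j) (j := i) (by omega) hlt (by omega) (by omega)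
    have hgi := hg.lt i hki (by omega)
    have hi' := root_of_le hki hgi
    have hne : g i ≠ g j := fun e => by
      have := hg.injOn i j hki (by omega) hkj hj e
      omega
    have := (ih (i := g i) (j := j) (by omega) (by omega) hj (by omega)).2
    omega

/-- The set partition whose arcs are the pairs `(g j, j)`, for `k ≤ j < n`. -/
noncomputable def arcPartition (g : ℕ → ℕ) (k n : ℕ) : SetPartition n :=
  haveI := Classical.decRel (Setoid.ker fun i : Fin n => root g k i).r
  Finpartition.ofSetoid (Setoid.ker fun i : Fin n => root g k i)

theorem mem_part_arcPartition {g : ℕ → ℕ} {k n : ℕ} {i j : Fin n} :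
    j ∈ (arcPartition g k n).part i ↔ root g k i = root g k j := by
  classical
  exact Finpartition.mem_part_ofSetoid_iff_rel

theorem IsArcSystem.isArc_iff {A : Finset ℕ} {k n : ℕ} {g : ℕ → ℕ} (hg : IsArcSystem A k n g)
    (i j : Fin n) : IsArc (arcPartition g k n) i j ↔ k ≤ (j : ℕ) ∧ g j = i := by
  set p := arcPartition g k n with hp
  constructor
  · rintro ⟨hij, B, hB, hi, hj, hbet⟩
    have hBi : p.part i = B := p.part_eq_of_mem hB hi
    rw [← hBi] at hj hbet
    have hr := mem_part_arcPartition.mp hj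
    obtain ⟨h1, h2⟩ := hg.le_of_root_eq _ le_rfl hij j.2 hr
    have hlt := hg.lt j h1 j.2
    refine ⟨h1, ?_⟩
    by_contra hne
    refine hbet ⟨g j, by omega⟩ (mem_part_arcPartition.mpr ?_) ⟨?_, hlt⟩
    · rw [hr, root_of_le h1 hlt]
    · exact lt_of_le_of_ne h2 fun h => hne (congrArg Fin.val h).symm
  · rintro ⟨h1, h2⟩
    have hlt := hg.lt j h1 j.2
    refine ⟨by rw [Fin.lt_def]; omega, p.part i, p.part_mem.mpr (mem_univ _),
      p.mem_part (mem_univ _), mem_part_arcPartition.mpr ?_, ?_⟩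
    · rw [root_of_le h1 hlt, h2]
    · rintro x hx ⟨hix, hxj⟩
      rw [mem_part_arcPartition] at hx
      have hr : root g k x = root g k j := by rw [← hx, root_of_le h1 hlt, h2]
      have := (hg.le_of_root_eq _ le_rfl hxj j.2 hr).2
      rw [Fin.lt_def] at hix
      omega

theorem IsArcSystem.cr_arcPartition {A : Finset ℕ} {k n : ℕ} {g : ℕ → ℕ}
    (hg : IsArcSystem A k n g) : cr (arcPartition g k n) = crossSum g k n := by
  rw [crossSum, ← card_sigma, ← Set.ncard_coe_finset, cr]
  refine Set.ncard_congr (fun e _ => ⟨(e.1.2 : ℕ), (e.2.2 : ℕ)⟩) ?_ ?_ ?_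
  · rintro ⟨⟨i, j⟩, ⟨i', j'⟩⟩ ⟨h1, h2, h3, h4, h5⟩
    rw [hg.isArc_iff] at h1 h2
    simp only [Fin.lt_def] at h1 h2 h3 h4 h5
    simp only [mem_coe, mem_sigma, mem_filter, mem_Ico]
    omega
  · rintro ⟨⟨i, j⟩, ⟨i', j'⟩⟩ ⟨⟨x, y⟩, ⟨x', y'⟩⟩ ⟨h1, h2, -⟩ ⟨h3, h4, -⟩ h
    rw [hg.isArc_iff] at h1 h2 h3 h4
    simp only [Sigma.mk.injEq, heq_eq_eq] at h
    simp only [Prod.mk.injEq, Fin.ext_iff]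
    simp only at h1 h2 h3 h4
    rw [← h1.2, ← h2.2, ← h3.2, ← h4.2, h.1, h.2]
    simp
  · rintro ⟨j, j'⟩ h
    simp only [mem_coe, mem_sigma, mem_filter, mem_Ico] at h
    obtain ⟨⟨h1, h2⟩, ⟨h3, h4⟩, h5, h6⟩ := h
    refine ⟨((⟨g j, by omega⟩, ⟨j, h2⟩), (⟨g j', by omega⟩, ⟨j', h4⟩)), ⟨?_, ?_, ?_⟩, rfl⟩
    · rw [hg.isArc_iff]; exact ⟨h1, rfl⟩
    · rw [hg.isArc_iff]; exact ⟨by simp only; omega, rfl⟩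
    · exact ⟨h5, h6, h3⟩

theorem IsArcSystem.uStat_arcPartition {A : Finset ℕ} {k n : ℕ} {g : ℕ → ℕ}
    (hg : IsArcSystem A k n g) {b : ℕ} (hb : b < k) :
    uStat (arcPartition g k n) b = (A.filter (· < b)).card := by
  rw [← Set.ncard_coe_finset, uStat]
  refine Set.ncard_congr (fun e _ => (e.1 : ℕ)) ?_ ?_ ?_
  · rintro ⟨i, j⟩ ⟨h1, h2, h3⟩
    rw [hg.isArc_iff] at h1
    simp only at h1 h2 h3
    simp only [mem_coe, mem_filter]
    exact ⟨h1.2 ▸ hg.mem j h1.1 j.2 (by omega), h2⟩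
  · rintro ⟨i, j⟩ ⟨x, y⟩ ⟨h1, -⟩ ⟨h2, -⟩ h
    rw [hg.isArc_iff] at h1 h2
    simp only at h1 h2 h
    have := hg.injOn j y h1.1 j.2 h2.1 y.2 (by omega)
    simp only [Prod.mk.injEq, Fin.ext_iff]
    exact ⟨h, this⟩
  · intro a ha
    simp only [mem_coe, mem_filter] at ha
    obtain ⟨j, h1, h2, h3⟩ := hg.surj a ha.1
    refine ⟨(⟨a, by omega⟩, ⟨j, h2⟩), ⟨?_, ha.2, ?_⟩, rfl⟩
    · rw [hg.isArc_iff]; exact ⟨h1, h3⟩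
    · simp only; omega

theorem minOfBlock_part_arcPartition {g : ℕ → ℕ} {k n : ℕ} (i : Fin n) (hi : (i : ℕ) < k) :
    minOfBlock ((arcPartition g k n).part i) = i := by
  have hmem : (i : ℕ) ∈ Fin.val '' (((arcPartition g k n).part i : Finset (Fin n)) : Set (Fin n)) :=
    ⟨i, mem_part_arcPartition.mpr rfl, rfl⟩
  refine le_antisymm (Nat.sInf_le hmem) (le_csInf ⟨_, hmem⟩ ?_)
  rintro _ ⟨j, hj, rfl⟩
  have := mem_part_arcPartition.mp (mem_coe.mp hj)
  rw [root_of_lt hi] at this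
  rw [this]
  exact root_le g k j

theorem IsArcSystem.parts_arcPartition {A : Finset ℕ} {k n : ℕ} {g : ℕ → ℕ}
    (hg : IsArcSystem A k n g) (hkn : k ≤ n) :
    ∃ f : Fin k ↪ Finset (Fin n), (arcPartition g k n).parts = univ.map f ∧
      ∀ b, minOfBlock (f b) = b := by
  set p := arcPartition g k n with hp
  have hmin : ∀ b : Fin k, minOfBlock (p.part (b.castLE hkn)) = b := fun b =>
    minOfBlock_part_arcPartition _ b.2
  refine ⟨⟨fun b => p.part (b.castLE hkn), fun a b h => ?_⟩, ?_, hmin⟩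
  · have := congrArg minOfBlock h
    simp only [hmin] at this
    exact Fin.ext this
  · ext B
    simp only [mem_map, mem_univ, true_and]
    constructor
    · intro hB
      obtain ⟨x, hx⟩ := p.nonempty_of_mem_parts hB
      have hr := hg.root_lt x.2
      refine ⟨⟨root g k x, hr⟩, ?_⟩
      rw [← p.part_eq_of_mem hB hx]
      refine p.part_eq_of_mem (p.part_mem.mpr (mem_univ _)) (mem_part_arcPartition.mpr ?_)
      exact (root_of_lt hr).symm
    · rintro ⟨b, rfl⟩
      exact p.part_mem.mpr (mem_univ _)

theorem card_filter_partialSum_le {S : ℕ → ℕ} (hS : Monotone S) {L i b : ℕ} (hi : i ≤ L)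
    (h1 : S i ≤ b) (h2 : b < S (i + 1)) :
    ((range L).filter fun t => S (t + 1) ≤ b).card = i := by
  have : ((range L).filter fun t => S (t + 1) ≤ b) = range i := by
    ext t
    rw [mem_filter, mem_range, mem_range]
    constructor
    · rintro ⟨-, h⟩
      by_contra! hit
      have := hS (Nat.add_le_add_right hit 1)
      omega
    · intro hti
      exact ⟨by omega, (hS hti).trans h1⟩
  rw [this, card_range]

theorem exists_partialSum_le_lt {S : ℕ → ℕ} (h0 : S 0 = 0) {l b : ℕ} (hb : b < S (l + 1)) :
    ∃ i ≤ l, S i ≤ b ∧ b < S (i + 1) := by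
  induction l with
  | zero => exact ⟨0, le_rfl, by omega, hb⟩
  | succ l ih =>
    by_cases h : b < S (l + 1)
    · obtain ⟨i, hi, h⟩ := ih h
      exact ⟨i, by omega, h⟩
    · exact ⟨l + 1, le_rfl, by omega, hb⟩

/-- Lemma 4.4(b). Given `n ≥ k ≥ 1`, a composition `(d₀,…,d_l)` of `k`
into `l+1 ≤ n-k+1` parts, and `0 ≤ c ≤ (n-k-1)·l - l(l-1)/2`, there is a partition of
`[n]` with exactly `k` blocks, `crset` equal to the multiset in which each `i ∈ {0,…,l}`
occurs exactly `d_i` times, and exactly `c` crossings. -/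
theorem statement14 {n k l : ℕ} (hk : 1 ≤ k) (hkn : k ≤ n) (d : ℕ → ℕ)
    (hd : ∀ i ≤ l, 1 ≤ d i) (hsum : ∑ i ∈ Finset.range (l + 1), d i = k)
    (hl : l + 1 ≤ n - k + 1) (c : ℕ) (hc : c ≤ (n - k - 1) * l - l * (l - 1) / 2) :
    ∃ p : SetPartition n, p.parts.card = k ∧
      (∀ i : ℕ, (crset p).count i = if i ≤ l then d i else 0) ∧
      cr p = c := by
  set S : ℕ → ℕ := fun i => ∑ t ∈ range i, d t with hSdef
  have hSsucc : ∀ i, S (i + 1) = S i + d i := fun i => sum_range_succ _ _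
  have hS : Monotone S := monotone_nat_of_le_succ fun i => by rw [hSsucc]; omega
  have hS0 : S 0 = 0 := rfl
  have hSk : S (l + 1) = k := hsum
  obtain ⟨m, rfl⟩ := Nat.exists_eq_add_of_le hkn
  simp only [Nat.add_sub_cancel_left] at hl hc
  obtain ⟨L, s, hLm, hlL, hLl, h0, hcL⟩ : ∃ L s, m = L + s ∧ l ≤ L ∧ L ≤ l + 1 ∧
      (L = 0 → s = 0) ∧ c ≤ s * (L - 1) + ∑ i ∈ range L, i := by
    rcases Nat.eq_or_lt_of_le (Nat.le_of_add_le_add_right hl) with rfl | hlt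
    · refine ⟨l, 0, rfl, le_rfl, by omega, fun _ => rfl, ?_⟩
      have h2 := sum_range_id_mul_two l
      rw [mul_comm (l - 1) l] at hc
      omega
    · obtain ⟨s, rfl⟩ := Nat.exists_eq_add_of_le hlt
      refine ⟨l + 1, s, rfl, by omega, le_rfl, by omega, ?_⟩
      have h1 := sum_range_id_mul_two l
      rw [sum_range_succ]
      rw [show l + 1 + s - 1 = l + s by omega, add_mul] at hc
      rw [Nat.add_sub_cancel]
      have h3 : l * l = l * (l - 1) + l := by
        cases l with
        | zero => rfl
        | succ l => rw [Nat.add_sub_cancel]; ring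
      omega
  have hlast : ∀ t < L, S t < S (t + 1) := fun t ht => by
    have := hd t (by omega)
    rw [hSsucc]
    omega
  have hinj : Set.InjOn (fun t => S (t + 1) - 1) (range L : Set ℕ) := by
    have hne : ∀ t t', t < t' → t' < L → S (t + 1) - 1 < S (t' + 1) - 1 := fun t t' h h' => by
      have h1 := hlast t' h'
      have h2 := hlast t (by omega)
      have h3 : S (t + 1) ≤ S t' := hS h
      omega
    intro t ht t' ht' h
    simp only [coe_range, Set.mem_Iio] at ht ht' h
    rcases lt_trichotomy t t' with hlt | heq | hlt
    · have := hne t t' hlt ht'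
      omega
    · exact heq
    · have := hne t' t hlt ht
      omega
  set A := (range L).image fun t => S (t + 1) - 1 with hAdef
  have hAcard : A.card = L := by rw [hAdef, card_image_of_injOn hinj, card_range]
  have hAk : ∀ x ∈ A, x < k := by
    intro x hx
    obtain ⟨t, ht, rfl⟩ := mem_image.mp hx
    rw [mem_range] at ht
    have h1 := hlast t ht
    have h2 : S (t + 1) ≤ S (l + 1) := hS (by omega)
    omega
  obtain ⟨g, hg, hgc⟩ := exists_isArcSystem_crossSum m k s c A hAk (by rw [hAcard, hLm])
    (by rwa [hAcard]) (by rwa [hAcard])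
  obtain ⟨f, hf, hfmin⟩ := hg.parts_arcPartition hkn
  have hfilter : ∀ b, (A.filter (· < b)).card =
      ((range L).filter fun t => S (t + 1) ≤ b).card := by
    intro b
    rw [hAdef, filter_image, card_image_of_injOn (hinj.mono (coe_subset.mpr (filter_subset _ _)))]
    refine congrArg card (filter_congr fun t ht => ?_)
    have := hlast t (mem_range.mp ht)
    omega
  have hu : ∀ i b, i ≤ l → S i ≤ b → b < S (i + 1) →
      uStat (arcPartition g k (k + m)) b = i := fun i b hi h1 h2 => by
    have h3 : S (i + 1) ≤ S (l + 1) := hS (by omega)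
    rw [hg.uStat_arcPartition (by omega), hfilter,
      card_filter_partialSum_le hS (by omega) h1 h2]
  refine ⟨arcPartition g k (k + m), by rw [hf, card_map, card_fin], fun i => ?_,
    by rw [hg.cr_arcPartition, hgc]⟩
  have hcr : crset (arcPartition g k (k + m)) =
      (range k).val.map fun b => uStat (arcPartition g k (k + m)) b := by
    rw [crset, hf, map_val, Multiset.map_map]
    simp only [Function.comp_def, hfmin]
    rw [← Nat.Iio_eq_range, ← Fin.map_valEmbedding_univ, map_val, Multiset.map_map]
    rfl
  rw [hcr, Multiset.count_map, ← filter_val, card_val]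
  split_ifs with hi
  · have : (range k).filter (fun b => i = uStat (arcPartition g k (k + m)) b) =
        Ico (S i) (S (i + 1)) := by
      ext b
      rw [mem_filter, mem_range, mem_Ico]
      constructor
      · rintro ⟨hb, h⟩
        obtain ⟨i', hi', h1, h2⟩ := exists_partialSum_le_lt hS0 (hSk ▸ hb)
        rw [h, hu i' b hi' h1 h2]
        exact ⟨h1, h2⟩
      · rintro ⟨h1, h2⟩
        have h3 : S (i + 1) ≤ S (l + 1) := hS (by omega)
        exact ⟨by omega, (hu i b hi h1 h2).symm⟩
    rw [this, Nat.card_Ico, hSsucc]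
    omega
  · rw [card_eq_zero, filter_eq_empty_iff]
    intro b hb h
    obtain ⟨i', hi', h1, h2⟩ := exists_partialSum_le_lt hS0 (hSk ▸ mem_range.mp hb)
    rw [hu i' b hi' h1 h2] at h
    omega
end
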